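/- arXiv:1602.02138 — 12 statements merged into one kernel-verified Lean document; each statement's English description precedes it below -/
import Mathlib

section
/- Let {a_n}_{n≥0} be a sequence of real numbers bounded above with sup_n a_n = a. If x_{−1}, x_0 > 0, then the corresponding solution {x_n} of the equation x_{n+1} = x_{n−1}·exp(a_n − x_{n−1} − x_n) satisfies 0 < x_n < e^{a−1} for all n ≥ 1. -/
/- Statement 0: If {a_n} is bounded above with sup a_n = A and x_{-1}, x_0 > 0, then the
solution of x_{n+1} = x_{n-1} exp(a_n - x_{n-1} - x_n) satisfies 0 < x_n < e^(A-1) for n ≥ 1.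
We index the solution by X : ℕ → ℝ with X n = x_{n-1}, so paper index n corresponds to X (n+1)
and the recurrence reads X (n+2) = X n * exp (a n - X n - X (n+1)). -/
theorem stmt_0 (a : ℕ → ℝ) (hBdd : BddAbove (Set.range a)) (A : ℝ) (hA : A = ⨆ n, a n)
    (X : ℕ → ℝ) (hx0 : 0 < X 0) (hx1 : 0 < X 1)
    (hrec : ∀ n : ℕ, X (n + 2) = X n * Real.exp (a n - X n - X (n + 1))) :
    ∀ n : ℕ, 2 ≤ n → 0 < X n ∧ X n < Real.exp (A - 1) := by
  have hpos : ∀ n, 0 < X n ∧ 0 < X (n + 1) := by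
    intro n
    induction n with
    | zero => exact ⟨hx0, hx1⟩
    | succ k ih => exact ⟨ih.2, by rw [hrec k]; exact mul_pos ih.1 (Real.exp_pos _)⟩
  intro n hn
  obtain ⟨k, rfl⟩ := Nat.exists_eq_add_of_le' hn
  refine ⟨(hpos (k + 2)).1, ?_⟩
  have ha : a k ≤ A := hA ▸ le_ciSup hBdd k
  have hk : X k ≤ Real.exp (X k - 1) := by linarith [Real.add_one_le_exp (X k - 1)]
  calc X (k + 2) = X k * Real.exp (a k - X k - X (k + 1)) := hrec k
    _ ≤ Real.exp (X k - 1) * Real.exp (a k - X k - X (k + 1)) := by gcongr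
    _ = Real.exp (a k - X (k + 1) - 1) := by rw [← Real.exp_add]; ring_nf
    _ < Real.exp (A - 1) := Real.exp_lt_exp.mpr (by linarith [(hpos k).2])
end

section
/- Let {a_n}_{n≥0} be a real sequence, let x_{−1}, x_0 > 0, let {x_n} be the solution of x_{n+1} = x_{n−1}·exp(a_n − x_{n−1} − x_n), and let {t_n} be defined by t_0 = x_0/(x_{−1}e^{−x_{−1}}) and t_{n+1} = e^{a_n}/t_n. Then x_n ≤ t_n/e for all n ≥ 0. -/
/-- The factor sequence is positive and relates consecutive terms of the solution. -/
theorem factor_pos_and_solution_eq (a X t : ℕ → ℝ) (hx0 : 0 < X 0) (hx1 : 0 < X 1)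
    (hrec : ∀ n : ℕ, X (n + 2) = X n * Real.exp (a n - X n - X (n + 1)))
    (ht0 : t 0 = X 1 / (X 0 * Real.exp (-X 0)))
    (htrec : ∀ n : ℕ, t (n + 1) = Real.exp (a n) / t n) (n : ℕ) :
    0 < t n ∧ X (n + 1) = t n * (X n * Real.exp (-X n)) := by
  induction n with
  | zero =>
    have h : 0 < X 0 * Real.exp (-X 0) := by positivity
    rw [ht0]
    exact ⟨div_pos hx1 h, (div_mul_cancel₀ _ h.ne').symm⟩
  | succ n ih =>
    obtain ⟨ht, hX⟩ := ih
    refine ⟨by rw [htrec]; positivity, ?_⟩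
    have hexp : Real.exp (a n - X n - X (n + 1)) =
        Real.exp (a n) * Real.exp (-X n) * Real.exp (-X (n + 1)) := by
      rw [← Real.exp_add, ← Real.exp_add]
      ring_nf
    calc X (n + 2) = Real.exp (a n) * (X n * Real.exp (-X n)) * Real.exp (-X (n + 1)) := by
          rw [hrec, hexp]; ring
      _ = Real.exp (a n) / t n * (t n * (X n * Real.exp (-X n))) * Real.exp (-X (n + 1)) := by
          rw [← mul_assoc (_ / _), div_mul_cancel₀ _ ht.ne']
      _ = t (n + 1) * (X (n + 1) * Real.exp (-X (n + 1))) := by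
          rw [htrec, ← hX, mul_assoc]

/- Statement 2: With x_{-1}, x_0 > 0, the solution of x_{n+1} = x_{n-1} exp(a_n - x_{n-1} - x_n)
and the factor sequence t_0 = x_0/(x_{-1} e^{-x_{-1}}), t_{n+1} = e^{a_n}/t_n satisfy
x_n ≤ t_n / e for all n ≥ 0.  We index X : ℕ → ℝ with X n = x_{n-1}; paper index n ≥ 0
corresponds to X (n+1). -/
theorem stmt_2 (a : ℕ → ℝ) (X t : ℕ → ℝ) (hx0 : 0 < X 0) (hx1 : 0 < X 1)
    (hrec : ∀ n : ℕ, X (n + 2) = X n * Real.exp (a n - X n - X (n + 1)))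
    (ht0 : t 0 = X 1 / (X 0 * Real.exp (-X 0)))
    (htrec : ∀ n : ℕ, t (n + 1) = Real.exp (a n) / t n) :
    ∀ n : ℕ, X (n + 1) ≤ t n / Real.exp 1 := by
  intro n
  obtain ⟨ht, hX⟩ := factor_pos_and_solution_eq a X t hx0 hx1 hrec ht0 htrec n
  rw [hX, div_eq_mul_inv, ← Real.exp_neg]
  exact mul_le_mul_of_nonneg_left (Real.mul_exp_neg_le_exp_neg_one _) ht.le
end

section
/- Assume {a_n}_{n≥0} is periodic with minimal period p and that σ = Σ_{j=1}^{p} (−1)^j a_{j−1} = 0. If t_0 = 1, then the solution {t_n} of t_{n+1} = e^{a_n}/t_n is periodic with period p, i.e. t_{n+p} = t_n for all n ≥ 0. -/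
/-- Closed form of the factor sequence started at `1`. -/
theorem factor_seq_eq_exp_alternating_sum (a t : ℕ → ℝ) (ht0 : t 0 = 1)
    (htrec : ∀ n : ℕ, t (n + 1) = Real.exp (a n) / t n) (n : ℕ) :
    t n = Real.exp ((-1) ^ n * ∑ j ∈ Finset.Icc 1 n, (-1 : ℝ) ^ j * a (j - 1)) := by
  induction n with
  | zero => simp [ht0]
  | succ k ih =>
    have hsq : (-1 : ℝ) ^ k * (-1) ^ k = 1 := by rw [← mul_pow]; simp
    rw [htrec, ih, ← Real.exp_sub, Finset.sum_Icc_succ_top (by omega), Nat.add_sub_cancel]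
    congr 1
    linear_combination (-a k) * hsq

/- Statement 3: If {a_n} is periodic with minimal period p, σ = Σ_{j=1}^p (-1)^j a_{j-1} = 0,
and t_0 = 1, then the solution of t_{n+1} = e^{a_n}/t_n satisfies t_{n+p} = t_n for all n ≥ 0. -/
theorem stmt_3 (a : ℕ → ℝ) (p : ℕ) (hp : 0 < p) (hper : Function.Periodic a p)
    (hmin : ∀ q : ℕ, 0 < q → Function.Periodic a q → p ≤ q)
    (hσ : (∑ j ∈ Finset.Icc 1 p, (-1 : ℝ) ^ j * a (j - 1)) = 0)
    (t : ℕ → ℝ) (ht0 : t 0 = 1)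
    (htrec : ∀ n : ℕ, t (n + 1) = Real.exp (a n) / t n) :
    ∀ n : ℕ, t (n + p) = t n := by
  intro n
  induction n with
  | zero => simp [factor_seq_eq_exp_alternating_sum a t ht0 htrec p, hσ, ht0]
  | succ k ih => rw [Nat.add_right_comm, htrec, htrec, ih, hper k]
end

section
/- Assume {a_n}_{n≥0} is bounded from above and x_0, x_{−1} > 0. Let {t_n} be defined by t_0 = x_0/(x_{−1}e^{−x_{−1}}) and t_{n+1} = e^{a_n}/t_n, and let {x_n} be the corresponding solution of x_{n+1} = x_{n−1}·exp(a_n − x_{n−1} − x_n). If the sequence {t_n} is unbounded, then there exists a strictly increasing sequence of indices n_k such that x_{n_k + 1} → 0 as k → ∞ (in particular, some subsequence of {x_n} converges to 0). -/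
/-- An unbounded real sequence has a subsequence tending to `+∞`. -/
theorem exists_strictMono_tendsto_atTop_of_not_bddAbove {t : ℕ → ℝ}
    (ht : ¬ BddAbove (Set.range t)) :
    ∃ φ : ℕ → ℕ, StrictMono φ ∧
      Filter.Tendsto (fun k => t (φ k)) Filter.atTop Filter.atTop := by
  have hfreq : ∀ n : ℕ, ∃ᶠ k in Filter.atTop, (n : ℝ) < t k := by
    intro n hn
    refine ht (Filter.IsBoundedUnder.bddAbove_range ⟨n, ?_⟩)
    rw [Filter.eventually_map]
    exact hn.mono fun k hk => not_lt.mp hk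
  obtain ⟨φ, hφ, h⟩ := Filter.extraction_forall_of_frequently hfreq
  exact ⟨φ, hφ, Filter.tendsto_atTop_mono (fun k => (h k).le) tendsto_natCast_atTop_atTop⟩

theorem mul_exp_neg_le_one (x : ℝ) : x * Real.exp (-x) ≤ 1 := by
  rw [Real.exp_neg, ← div_eq_mul_inv, div_le_one (Real.exp_pos x)]
  linarith [Real.add_one_le_exp x]

/- Statement 4: If {a_n} is bounded above, x_{-1}, x_0 > 0, and the factor sequence {t_n}
(with t_0 = x_0/(x_{-1} e^{-x_{-1}}), t_{n+1} = e^{a_n}/t_n) is unbounded, then there is a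
strictly increasing sequence of indices n_k with x_{n_k + 1} → 0. We index X : ℕ → ℝ with
X n = x_{n-1}, so paper x_{n_k + 1} is X (n_k + 2). -/
theorem stmt_4 (a : ℕ → ℝ) (hBdd : BddAbove (Set.range a)) (X t : ℕ → ℝ)
    (hx0 : 0 < X 0) (hx1 : 0 < X 1)
    (hrec : ∀ n : ℕ, X (n + 2) = X n * Real.exp (a n - X n - X (n + 1)))
    (ht0 : t 0 = X 1 / (X 0 * Real.exp (-X 0)))
    (htrec : ∀ n : ℕ, t (n + 1) = Real.exp (a n) / t n)
    (hUnb : ¬ BddAbove (Set.range t)) :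
    ∃ φ : ℕ → ℕ, StrictMono φ ∧
      Filter.Tendsto (fun k => X (φ k + 2)) Filter.atTop (nhds 0) := by
  obtain ⟨M, hM⟩ := hBdd
  have hX : ∀ n, 0 < X n ∧ 0 < X (n + 1) := by
    intro n
    induction n with
    | zero => exact ⟨hx0, hx1⟩
    | succ n ih => exact ⟨ih.2, by rw [hrec]; exact mul_pos ih.1 (Real.exp_pos _)⟩
  have ht : ∀ n, 0 < t n := by
    intro n
    induction n with
    | zero => rw [ht0]; positivity
    | succ n ih => rw [htrec]; positivity
  have hfactor : ∀ n, X (n + 1) = t n * (X n * Real.exp (-X n)) := by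
    intro n
    induction n with
    | zero => rw [ht0]; field_simp
    | succ n ih =>
      have hsplit : Real.exp (a n - X n - X (n + 1)) =
          Real.exp (a n) * Real.exp (-X n) * Real.exp (-X (n + 1)) := by
        rw [← Real.exp_add, ← Real.exp_add]
        ring_nf
      have htn := (ht n).ne'
      calc X (n + 2) = Real.exp (a n) / t n *
            (t n * (X n * Real.exp (-X n)) * Real.exp (-X (n + 1))) := by
            rw [hrec, hsplit]; field_simp
        _ = t (n + 1) * (X (n + 1) * Real.exp (-X (n + 1))) := by rw [← ih, htrec]
  have hbound : ∀ n, X (n + 2) ≤ Real.exp M / t n := by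
    intro n
    calc X (n + 2) = t (n + 1) * (X (n + 1) * Real.exp (-X (n + 1))) := hfactor (n + 1)
      _ ≤ t (n + 1) := mul_le_of_le_one_right (ht _).le (mul_exp_neg_le_one _)
      _ = Real.exp (a n) / t n := htrec n
      _ ≤ Real.exp M / t n :=
        div_le_div_of_nonneg_right (Real.exp_le_exp.mpr (hM ⟨n, rfl⟩)) (ht n).le
  obtain ⟨φ, hφ, hlim⟩ := exists_strictMono_tendsto_atTop_of_not_bddAbove hUnb
  exact ⟨φ, hφ, squeeze_zero (fun k => (hX (φ k + 1)).2.le) (fun k => hbound (φ k))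
    (hlim.const_div_atTop (Real.exp M))⟩
end

section
/- Suppose {a_n}_{n≥0} is a periodic sequence of real numbers with minimal odd period p ≥ 1, and let {t_n} be a solution of t_{n+1} = e^{a_n}/t_n with t_0 ≠ 0. Then {t_n} is periodic with period 2p, i.e. t_{n+2p} = t_n for all n ≥ 0; moreover a full cycle {t_0, t_1, …, t_{2p−1}} is given by t_k = t_0^{(−1)^k}·exp((−1)^k s_k), where s_k = Σ_{j=1}^{k} (−1)^j a_{j−1} for 1 ≤ k ≤ p and s_k = Σ_{j=k}^{2p−1} (−1)^j a_{j−p} for p+1 ≤ k ≤ 2p−1. -/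
/- The piecewise sums s_k of Lemma ptk(a): s_k = Σ_{j=1}^k (-1)^j a_{j-1} for 1 ≤ k ≤ p and
s_k = Σ_{j=k}^{2p-1} (-1)^j a_{j-p} for p+1 ≤ k ≤ 2p-1. -/
noncomputable def sOdd (a : ℕ → ℝ) (p k : ℕ) : ℝ :=
  if k ≤ p then ∑ j ∈ Finset.Icc 1 k, (-1 : ℝ) ^ j * a (j - 1)
  else ∑ j ∈ Finset.Icc k (2 * p - 1), (-1 : ℝ) ^ j * a (j - p)

/-- The alternating sum `Σ_{j < n} (-1)^(j+1) a_j`. -/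
noncomputable def altSum (a : ℕ → ℝ) (n : ℕ) : ℝ :=
  ∑ j ∈ Finset.range n, (-1 : ℝ) ^ (j + 1) * a j

lemma altSum_succ (a : ℕ → ℝ) (n : ℕ) :
    altSum a (n + 1) = altSum a n + (-1 : ℝ) ^ (n + 1) * a n :=
  Finset.sum_range_succ _ _

lemma altSum_add_odd_period {a : ℕ → ℝ} {p : ℕ} (hodd : Odd p) (hper : Function.Periodic a p)
    (m : ℕ) : altSum a (p + m) = altSum a p - altSum a m := by
  induction m with
  | zero => simp [altSum]
  | succ m ih =>
    rw [← add_assoc, altSum_succ, altSum_succ, ih, add_comm p m, hper m, add_right_comm,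
      pow_add _ _ p, hodd.neg_one_pow]
    ring

lemma altSum_add_two_mul_odd_period {a : ℕ → ℝ} {p : ℕ} (hodd : Odd p)
    (hper : Function.Periodic a p) (n : ℕ) : altSum a (n + 2 * p) = altSum a n := by
  rw [show n + 2 * p = p + (p + n) by ring, altSum_add_odd_period hodd hper,
    altSum_add_odd_period hodd hper]
  ring

lemma sum_Icc_one_eq_altSum (a : ℕ → ℝ) (k : ℕ) :
    ∑ j ∈ Finset.Icc 1 k, (-1 : ℝ) ^ j * a (j - 1) = altSum a k := by
  induction k with
  | zero => simp [altSum]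
  | succ k ih => rw [Finset.sum_Icc_succ_top (by omega), ih, altSum_succ, Nat.add_sub_cancel]

lemma sOdd_eq_altSum {a : ℕ → ℝ} {p k : ℕ} (hodd : Odd p) (hper : Function.Periodic a p)
    (hk : k ≤ 2 * p - 1) : sOdd a p k = altSum a k := by
  unfold sOdd
  split_ifs with hkp
  · exact sum_Icc_one_eq_altSum a k
  · have hIcc : Finset.Icc k (2 * p - 1) = Finset.Ico k (2 * p) := by
      ext j
      simp only [Finset.mem_Icc, Finset.mem_Ico]
      omega
    have hsum : ∑ j ∈ Finset.Ico k (2 * p), (-1 : ℝ) ^ j * a (j - p) =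
        -∑ j ∈ Finset.Ico k (2 * p), (-1 : ℝ) ^ (j + 1) * a j := by
      rw [← Finset.sum_neg_distrib]
      refine Finset.sum_congr rfl fun j hj => ?_
      have hj' : j - p + p = j := by
        have := (Finset.mem_Ico.mp hj).1
        omega
      rw [← hper (j - p), hj']
      ring
    have hzero : altSum a (2 * p) = 0 := by
      simpa [altSum] using altSum_add_two_mul_odd_period hodd hper 0
    rw [hIcc, hsum, Finset.sum_Ico_eq_sub _ (by omega : k ≤ 2 * p)]
    change -(altSum a (2 * p) - altSum a k) = altSum a k
    rw [hzero]
    ring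

lemma factor_eq_zpow_mul_exp_altSum {a t : ℕ → ℝ}
    (htrec : ∀ n : ℕ, t (n + 1) = Real.exp (a n) / t n) (n : ℕ) :
    t n = t 0 ^ ((-1 : ℤ) ^ n) * Real.exp ((-1 : ℝ) ^ n * altSum a n) := by
  induction n with
  | zero => simp [altSum]
  | succ n ih =>
    have hexp : (-1 : ℝ) ^ (n + 1) * altSum a (n + 1) = a n - (-1 : ℝ) ^ n * altSum a n := by
      have hsq : (-1 : ℝ) ^ (n + 1) * (-1 : ℝ) ^ (n + 1) = 1 := by
        rw [← mul_pow]
        simp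
      rw [altSum_succ]
      linear_combination a n * hsq
    rw [htrec, hexp, ih, pow_succ, mul_neg_one, zpow_neg, Real.exp_sub, div_eq_mul_inv,
      mul_inv, div_eq_mul_inv]
    ring

/- Statement 5: If {a_n} is periodic with minimal odd period p ≥ 1 and {t_n} solves
t_{n+1} = e^{a_n}/t_n with t_0 ≠ 0, then {t_n} has period 2p, and a full cycle
{t_0, ..., t_{2p-1}} is given by t_k = t_0^{(-1)^k} exp((-1)^k s_k). -/
theorem stmt_5 (a : ℕ → ℝ) (p : ℕ) (hp : 1 ≤ p) (hodd : Odd p)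
    (hper : Function.Periodic a p)
    (hmin : ∀ q : ℕ, 0 < q → Function.Periodic a q → p ≤ q)
    (t : ℕ → ℝ) (ht0 : t 0 ≠ 0)
    (htrec : ∀ n : ℕ, t (n + 1) = Real.exp (a n) / t n) :
    (∀ n : ℕ, t (n + 2 * p) = t n) ∧
      (∀ k : ℕ, 1 ≤ k → k ≤ 2 * p - 1 →
        t k = t 0 ^ ((-1 : ℤ) ^ k) * Real.exp ((-1 : ℝ) ^ k * sOdd a p k)) := by
  have ht := factor_eq_zpow_mul_exp_altSum htrec
  refine ⟨fun n => ?_, fun k _ hk => ?_⟩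
  · rw [ht (n + 2 * p), ht n, altSum_add_two_mul_odd_period hodd hper]
    simp [pow_add, pow_mul]
  · rw [sOdd_eq_altSum hodd hper hk]
    exact ht k
end

section
/- Suppose {a_n}_{n≥0} is periodic with minimal odd period p ≥ 1 and set σ = Σ_{j=1}^{p} (−1)^j a_{j−1}. If t_0 = e^{−σ/2}, then the solution {t_n} of t_{n+1} = e^{a_n}/t_n is periodic with period p, i.e. t_{n+p} = t_n for all n ≥ 0. -/
/-- Closed form of the factor sequence started at `exp x`. -/
theorem factor_sequence_eq_exp (a t : ℕ → ℝ) (x : ℝ) (ht0 : t 0 = Real.exp x)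
    (htrec : ∀ n : ℕ, t (n + 1) = Real.exp (a n) / t n) (n : ℕ) :
    t n = Real.exp ((-1) ^ n * (x + ∑ j ∈ Finset.Icc 1 n, (-1 : ℝ) ^ j * a (j - 1))) := by
  induction n with
  | zero => simp [ht0]
  | succ n ih =>
    rw [htrec, ih, ← Real.exp_sub, Finset.sum_Icc_succ_top (by omega), Nat.add_sub_cancel]
    congr 1
    have h : (-1 : ℝ) ^ n * (-1) ^ n = 1 := by rw [← mul_pow]; norm_num
    rw [pow_succ]
    linear_combination (-a n) * h

/- Statement 6: If {a_n} is periodic with minimal odd period p ≥ 1,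
σ = Σ_{j=1}^p (-1)^j a_{j-1}, and t_0 = e^{-σ/2}, then the solution of
t_{n+1} = e^{a_n}/t_n satisfies t_{n+p} = t_n for all n ≥ 0. -/
theorem stmt_6 (a : ℕ → ℝ) (p : ℕ) (hp : 1 ≤ p) (hodd : Odd p)
    (hper : Function.Periodic a p)
    (hmin : ∀ q : ℕ, 0 < q → Function.Periodic a q → p ≤ q)
    (σ : ℝ) (hσ : σ = ∑ j ∈ Finset.Icc 1 p, (-1 : ℝ) ^ j * a (j - 1))
    (t : ℕ → ℝ) (ht0 : t 0 = Real.exp (-σ / 2))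
    (htrec : ∀ n : ℕ, t (n + 1) = Real.exp (a n) / t n) :
    ∀ n : ℕ, t (n + p) = t n := by
  intro n
  induction n with
  | zero =>
    rw [Nat.zero_add, factor_sequence_eq_exp a t _ ht0 htrec p, ← hσ, hodd.neg_one_pow, ht0]
    congr 1
    ring
  | succ n ih => rw [Nat.add_right_comm, htrec, htrec, ih, hper n]
end

section
/- Let {a_n}_{n≥0} be a bounded real sequence with ρ = inf_{n≥0} a_n ∈ (0,2), let x_0, x_{−1} > 0, let {t_n} be defined by t_0 = x_0/(x_{−1}e^{−x_{−1}}) and t_{n+1} = e^{a_n}/t_n, and let {x_n} be the corresponding solution of x_{n+1} = x_{n−1}·exp(a_n − x_{n−1} − x_n). If the sequence {t_{2n+1}}_{n≥0} is bounded, then there exists an interval [α, β] with 0 < α ≤ β such that whenever x_{−1}, x_0 ∈ [α, β], the even-indexed terms satisfy x_{2n} ∈ [α, β] for all n ≥ 1. -/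
/-- The map `y ↦ y * exp (b - y - s * y * exp (-y))` admits an interval that contains `[m, M]` and
is invariant for all parameters `ρ ≤ b ≤ A` and `0 ≤ s ≤ T` at once. -/
lemma exists_uniform_invariant_Icc {ρ A T m M : ℝ} (hρ : 0 < ρ) (hT : 0 ≤ T) (hm : 0 < m) :
    ∃ α β : ℝ, 0 < α ∧ α ≤ m ∧ M ≤ β ∧ ∀ b s y : ℝ, ρ ≤ b → b ≤ A → 0 ≤ s → s ≤ T →
      y ∈ Set.Icc α β → y * Real.exp (b - y - s * y * Real.exp (-y)) ∈ Set.Icc α β := by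
  set δ : ℝ := ρ / (1 + T) with hδ
  set β : ℝ := max M (Real.exp (A - 1))
  have hδ0 : 0 < δ := by positivity
  have hδρ : (1 + T) * δ = ρ := by rw [hδ]; field_simp
  have hα0 : 0 < min m (δ * Real.exp (ρ - (1 + T) * β)) := by positivity
  refine ⟨_, β, hα0, min_le_left _ _, le_max_left _ _, ?_⟩
  rintro b s y hb hbA hs hsT ⟨hαy, hyβ⟩
  have hy : 0 < y := hα0.trans_le hαy
  have hsy : s * y * Real.exp (-y) ≤ T * y := by
    have h1 : Real.exp (-y) ≤ 1 := Real.exp_le_one_iff.2 (by linarith)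
    calc s * y * Real.exp (-y) ≤ s * y := mul_le_of_le_one_right (by positivity) h1
      _ ≤ T * y := by gcongr
  constructor
  · have hexp : Real.exp (ρ - (1 + T) * y) ≤ Real.exp (b - y - s * y * Real.exp (-y)) :=
      Real.exp_le_exp.2 (by linarith)
    rcases le_total y δ with hyδ | hyδ
    · have h1 : 1 ≤ Real.exp (ρ - (1 + T) * y) := by
        apply Real.one_le_exp
        have : (1 + T) * y ≤ (1 + T) * δ := by gcongr
        linarith
      exact hαy.trans (le_mul_of_one_le_right hy.le (h1.trans hexp))
    · calc min m (δ * Real.exp (ρ - (1 + T) * β))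
          ≤ δ * Real.exp (ρ - (1 + T) * β) := min_le_right _ _
        _ ≤ y * Real.exp (ρ - (1 + T) * y) := by gcongr
        _ ≤ _ := by gcongr
  · have hpos : 0 ≤ s * y * Real.exp (-y) := by positivity
    calc y * Real.exp (b - y - s * y * Real.exp (-y))
        ≤ Real.exp (y - 1) * Real.exp (A - y) := by
          apply mul_le_mul _ (Real.exp_le_exp.2 (by linarith)) (by positivity) (by positivity)
          linarith [Real.add_one_le_exp (y - 1)]
      _ = Real.exp (A - 1) := by rw [← Real.exp_add]; ring_nf
      _ ≤ β := le_max_right _ _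

/-- The factor sequence is positive and reduces the second order equation to a first order one. -/
lemma factor_reduction {a X t : ℕ → ℝ} (hx0 : 0 < X 0) (hx1 : 0 < X 1)
    (hrec : ∀ n : ℕ, X (n + 2) = X n * Real.exp (a n - X n - X (n + 1)))
    (ht0 : t 0 = X 1 / (X 0 * Real.exp (-X 0)))
    (htrec : ∀ n : ℕ, t (n + 1) = Real.exp (a n) / t n) (n : ℕ) :
    0 < t n ∧ X (n + 1) = t n * X n * Real.exp (-X n) := by
  induction n with
  | zero =>
    rw [ht0]
    exact ⟨by positivity, by field_simp⟩
  | succ n ih =>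
    obtain ⟨ht, hX⟩ := ih
    rw [htrec]
    refine ⟨by positivity, ?_⟩
    have hexp : Real.exp (a n - X n - X (n + 1))
        = Real.exp (a n) * Real.exp (-X n) * Real.exp (-X (n + 1)) := by
      rw [← Real.exp_add, ← Real.exp_add]; ring_nf
    calc X (n + 1 + 1)
        = Real.exp (a n) / t n * (t n * X n * Real.exp (-X n)) * Real.exp (-X (n + 1)) := by
          rw [hrec, hexp]; field_simp
      _ = _ := by rw [← hX]

/- Statement 7: Invariant interval for the even-indexed terms. {a_n} is bounded with
ρ = inf a_n ∈ (0,2); x_{-1}, x_0 > 0; t is the factor sequence; if {t_{2n+1}} is bounded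
then there is an interval [α,β], α > 0, such that if x_{-1}, x_0 ∈ [α,β] then
x_{2n} ∈ [α,β] for all n ≥ 1.  We index X : ℕ → ℝ with X n = x_{n-1}; paper x_{2n} is
X (2n+1), and x_{-1}, x_0 are X 0, X 1. -/
theorem stmt_7 (a : ℕ → ℝ) (hBdd : BddAbove (Set.range a))
    (ρ : ℝ) (hρ : IsGLB (Set.range a) ρ) (hρ0 : 0 < ρ) (hρ2 : ρ < 2)
    (X t : ℕ → ℝ) (hx0 : 0 < X 0) (hx1 : 0 < X 1)
    (hrec : ∀ n : ℕ, X (n + 2) = X n * Real.exp (a n - X n - X (n + 1)))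
    (ht0 : t 0 = X 1 / (X 0 * Real.exp (-X 0)))
    (htrec : ∀ n : ℕ, t (n + 1) = Real.exp (a n) / t n)
    (htb : BddAbove (Set.range fun n => t (2 * n + 1))) :
    ∃ α β : ℝ, 0 < α ∧ α ≤ β ∧
      (X 0 ∈ Set.Icc α β → X 1 ∈ Set.Icc α β →
        ∀ n : ℕ, 1 ≤ n → X (2 * n + 1) ∈ Set.Icc α β) := by
  obtain ⟨A, hA⟩ := hBdd
  obtain ⟨T, hT⟩ := htb
  have hred := factor_reduction hx0 hx1 hrec ht0 htrec
  have htT (n : ℕ) : t (2 * n + 1) ≤ T := hT ⟨n, rfl⟩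
  obtain ⟨α, β, hα, hαm, hMβ, hinv⟩ := exists_uniform_invariant_Icc (A := A) hρ0
    ((hred _).1.le.trans (htT 0)) (lt_min hx0 hx1) (M := max (X 0) (X 1))
  refine ⟨α, β, hα, (hαm.trans min_le_max).trans hMβ, fun _ hX1 n _ => ?_⟩
  induction n with
  | zero => exact hX1
  | succ n ih =>
    have hstep : X (2 * (n + 1) + 1) = X (2 * n + 1) * Real.exp (a (2 * n + 1) - X (2 * n + 1)
        - t (2 * n + 1) * X (2 * n + 1) * Real.exp (-X (2 * n + 1))) := by
      rw [← (hred (2 * n + 1)).2]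
      exact hrec (2 * n + 1)
    rw [hstep]
    refine hinv _ _ _ (hρ.1 ⟨_, rfl⟩) (hA ⟨_, rfl⟩) (hred _).1.le (htT n) ?_
    rcases Nat.eq_zero_or_pos n with rfl | hn
    · exact hX1
    · exact ih hn
end

section
/- Let {a_n}_{n≥0} be a bounded real sequence with ρ = inf_{n≥0} a_n ∈ (0,2), let x_0, x_{−1} > 0, let {t_n} be defined by t_0 = x_0/(x_{−1}e^{−x_{−1}}) and t_{n+1} = e^{a_n}/t_n, and let {x_n} be the corresponding solution of x_{n+1} = x_{n−1}·exp(a_n − x_{n−1} − x_n). If the sequence {t_{2n+1}}_{n≥0} is bounded, then there exists an interval [α, β] with 0 < α ≤ β and an integer N > 0 such that x_{2n} ∈ [α, β] for all n ≥ N; the analogous statement holds for the odd-indexed terms x_{2n+1} when {t_{2n}}_{n≥0} is bounded. -/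
open Real in
/-- A positive orbit of the Ricker-type recursion `y ↦ y * exp (b - y - z)` with `b` between two
constants, the lower one positive, and `0 ≤ z ≤ T * y`, is bounded above and away from zero. -/
lemma ricker_orbit_mem_Icc {y b z : ℕ → ℝ} {ρ A T : ℝ} (hρ : 0 < ρ) (hT : 0 ≤ T)
    (hy : ∀ n, 0 < y n) (hb : ∀ n, ρ ≤ b n) (hA : ∀ n, b n ≤ A)
    (hz : ∀ n, 0 ≤ z n) (hzT : ∀ n, z n ≤ T * y n)
    (hrec : ∀ n, y (n + 1) = y n * exp (b n - y n - z n)) :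
    ∃ α β : ℝ, 0 < α ∧ α ≤ β ∧ ∀ n, y n ∈ Set.Icc α β := by
  obtain ⟨M, hM⟩ : ∃ M, ∀ n, y n ≤ M := by
    refine ⟨max (y 0) (exp A), fun n => ?_⟩
    cases n with
    | zero => exact le_max_left _ _
    | succ n =>
      refine le_max_of_le_right ?_
      calc y (n + 1) = y n * exp (b n - y n - z n) := hrec n
        _ ≤ exp (y n) * exp (b n - y n - z n) := by
          gcongr
          linarith [add_one_le_exp (y n)]
        _ = exp (b n - z n) := by rw [← exp_add]; ring_nf
        _ ≤ exp A := exp_le_exp.2 (by linarith [hA n, hz n])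
  set δ := ρ / (1 + T)
  have hδ : 0 < δ := by positivity
  have hδρ : δ * (1 + T) = ρ := div_mul_cancel₀ _ (by positivity)
  have hlower : ∀ n, min (y 0) (δ * exp (ρ - M - T * M)) ≤ y n := by
    intro n
    induction n with
    | zero => exact min_le_left _ _
    | succ n ih =>
      rcases le_total (y n) δ with h | h
      · have hexp : 0 ≤ b n - y n - z n := by
          nlinarith [hb n, hzT n, mul_le_mul_of_nonneg_right h (by positivity : 0 ≤ 1 + T)]
        rw [hrec n]
        exact ih.trans (le_mul_of_one_le_right (hy n).le (one_le_exp hexp))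
      · refine (min_le_right _ _).trans ?_
        rw [hrec n]
        have hexp : ρ - M - T * M ≤ b n - y n - z n := by
          linarith [hb n, hzT n, hM n, mul_le_mul_of_nonneg_left (hM n) hT]
        exact mul_le_mul h (exp_le_exp.2 hexp) (exp_pos _).le (hy n).le
  exact ⟨_, M, lt_min (hy 0) (by positivity), (hlower 0).trans (hM 0),
    fun n => ⟨hlower n, hM n⟩⟩

/- Statement 8: Absorbing interval. {a_n} bounded with ρ = inf a_n ∈ (0,2); x_{-1}, x_0 > 0;
t the factor sequence.  If {t_{2n+1}} is bounded then there are [α,β] with 0 < α ≤ β and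
N > 0 with x_{2n} ∈ [α,β] for all n ≥ N; analogously, if {t_{2n}} is bounded then the
odd-indexed terms x_{2n+1} eventually lie in such an interval.  We index X : ℕ → ℝ with
X n = x_{n-1}; paper x_{2n} is X (2n+1) and x_{2n+1} is X (2n+2). -/
theorem stmt_8 (a : ℕ → ℝ) (hBdd : BddAbove (Set.range a))
    (ρ : ℝ) (hρ : IsGLB (Set.range a) ρ) (hρ0 : 0 < ρ) (hρ2 : ρ < 2)
    (X t : ℕ → ℝ) (hx0 : 0 < X 0) (hx1 : 0 < X 1)
    (hrec : ∀ n : ℕ, X (n + 2) = X n * Real.exp (a n - X n - X (n + 1)))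
    (ht0 : t 0 = X 1 / (X 0 * Real.exp (-X 0)))
    (htrec : ∀ n : ℕ, t (n + 1) = Real.exp (a n) / t n) :
    (BddAbove (Set.range fun n => t (2 * n + 1)) →
      ∃ α β : ℝ, ∃ N : ℕ, 0 < α ∧ α ≤ β ∧ 0 < N ∧
        ∀ n : ℕ, N ≤ n → X (2 * n + 1) ∈ Set.Icc α β) ∧
    (BddAbove (Set.range fun n => t (2 * n)) →
      ∃ α β : ℝ, ∃ N : ℕ, 0 < α ∧ α ≤ β ∧ 0 < N ∧
        ∀ n : ℕ, N ≤ n → X (2 * n + 2) ∈ Set.Icc α β) := by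
  have hX : ∀ n, 0 < X n ∧ 0 < X (n + 1) := by
    intro n
    induction n with
    | zero => exact ⟨hx0, hx1⟩
    | succ n ih => exact ⟨ih.2, by rw [hrec n]; exact mul_pos ih.1 (Real.exp_pos _)⟩
  have hpos : ∀ n, 0 < X n := fun n => (hX n).1
  have hfactor : ∀ n, 0 < t n ∧ X (n + 1) = t n * (X n * Real.exp (-X n)) := by
    intro n
    induction n with
    | zero =>
      have hden : 0 < X 0 * Real.exp (-X 0) := mul_pos hx0 (Real.exp_pos _)
      rw [ht0]
      exact ⟨div_pos hx1 hden, (div_mul_cancel₀ _ hden.ne').symm⟩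
    | succ n ih =>
      obtain ⟨htn, hXn⟩ := ih
      rw [htrec n]
      refine ⟨div_pos (Real.exp_pos _) htn, ?_⟩
      have hexp : Real.exp (a n - X n - X (n + 1))
          = Real.exp (a n) * Real.exp (-X n) * Real.exp (-X (n + 1)) := by
        rw [← Real.exp_add, ← Real.exp_add]
        ring_nf
      calc X (n + 2) = Real.exp (a n) * (X n * Real.exp (-X n)) * Real.exp (-X (n + 1)) := by
            rw [hrec n, hexp]; ring
        _ = Real.exp (a n) * (X (n + 1) / t n) * Real.exp (-X (n + 1)) := by
            rw [eq_div_of_mul_eq htn.ne' ((mul_comm _ _).trans hXn.symm)]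
        _ = Real.exp (a n) / t n * (X (n + 1) * Real.exp (-X (n + 1))) := by ring
  have hstep : ∀ n T, t n ≤ T → X (n + 1) ≤ T * X n := by
    intro n T hT
    rw [(hfactor n).2]
    exact mul_le_mul hT
      (mul_le_of_le_one_right (hpos n).le (Real.exp_le_one_iff.2 (by linarith [hpos n])))
      (mul_pos (hpos n) (Real.exp_pos _)).le ((hfactor n).1.le.trans hT)
  obtain ⟨A, hA⟩ := hBdd
  have haA : ∀ n, a n ≤ A := fun n => hA ⟨n, rfl⟩
  have hρa : ∀ n, ρ ≤ a n := fun n => hρ.1 ⟨n, rfl⟩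
  have habsorb : ∀ k T, (∀ n, t (2 * n + k) ≤ T) →
      ∃ α β : ℝ, 0 < α ∧ α ≤ β ∧ ∀ n, X (2 * n + k) ∈ Set.Icc α β := by
    intro k T hT
    refine ricker_orbit_mem_Icc (b := fun n => a (2 * n + k)) (z := fun n => X (2 * n + k + 1))
      hρ0 ((hfactor _).1.le.trans (hT 0)) (fun n => hpos _) (fun n => hρa _) (fun n => haA _)
      (fun n => (hpos _).le) (fun n => hstep _ _ (hT n)) (fun n => ?_)
    rw [← hrec (2 * n + k)]
    congr 1
    ring
  constructor
  · rintro ⟨T, hT⟩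
    obtain ⟨α, β, hα, hαβ, h⟩ := habsorb 1 T fun n => hT ⟨n, rfl⟩
    exact ⟨α, β, 1, hα, hαβ, one_pos, fun n _ => h n⟩
  · rintro ⟨T, hT⟩
    obtain ⟨α, β, hα, hαβ, h⟩ := habsorb 2 T fun n => hT ⟨n + 1, rfl⟩
    exact ⟨α, β, 1, hα, hαβ, one_pos, fun n _ => h n⟩
end

section
/- Let {a_n}_{n≥0} be periodic with period p and 0 < a_n < 2 for all n; set a = max_{0≤i≤p−1} a_i, β = e^{a−1}, and let α ∈ (0, β]. Let {x_n} be a solution of x_{n+1} = x_{n−1}·exp(a_n − x_{n−1} − x_n) whose terms all lie in [α, β], and write y_n = x_{2n}, z_n = x_{2n−1}. Then there exist constants K > 0 and δ ∈ (0,1) such that |∏_{i=0}^{n−1} (1 − y_i)(1 − z_i)| ≤ K·δ^n for all n ≥ 1. -/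
open Real in
/-- For `9/10 ≤ η < 1`, the weight `max η |1 - x|` contracts by the factor `η` along
`x ↦ y`, whenever `1 - η ≤ y ≤ x * exp (1 + η - x)`. -/
lemma abs_one_sub_mul_weight_le {η x y : ℝ} (hη : 9 / 10 ≤ η) (hη1 : η < 1)
    (hx : 1 - η ≤ x) (hy : 1 - η ≤ y) (hle : y ≤ x * exp (1 + η - x)) :
    |1 - x| * max η |1 - y| ≤ η * max η |1 - x| := by
  have hx0 : 0 < x := by linarith
  rcases le_or_gt |1 - x| η with h | h
  · obtain ⟨h1, h2⟩ := abs_le.mp h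
    rw [max_eq_left h, mul_max_of_nonneg _ _ (abs_nonneg _)]
    refine max_le (by nlinarith) ?_
    rcases le_total 1 y with hc | hc
    · rw [abs_of_nonpos (by linarith : 1 - y ≤ 0)]
      rcases le_total x 1 with hx1 | hx1
      · rw [abs_of_nonneg (by linarith : 0 ≤ 1 - x)]
        have he2 : exp 2 ≤ 7.39 := by
          have h2 : exp 2 = exp 1 * exp 1 := by rw [← exp_add]; norm_num
          have := exp_one_lt_d9
          have := exp_pos 1
          rw [h2]; nlinarith
        have hmul : exp (1 + η - x) * (1 + x) ≤ 7.39 := by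
          calc exp (1 + η - x) * (1 + x) ≤ exp (2 - x) * exp x := by
                gcongr
                · linarith
                · linarith [add_one_le_exp x]
            _ = exp 2 := by rw [← exp_add]; ring_nf
            _ ≤ 7.39 := he2
        have hub : y * (1 + x) ≤ 7.39 * x := by
          calc y * (1 + x) ≤ x * exp (1 + η - x) * (1 + x) := by gcongr
            _ = x * (exp (1 + η - x) * (1 + x)) := by ring
            _ ≤ x * 7.39 := by gcongr
            _ = 7.39 * x := by ring
        have key : (1 - x) * (y - 1) ≤ 0.8 := by
          have hq : (1 - x) * (y * (1 + x)) ≤ (1 - x) * (7.39 * x) :=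
            mul_le_mul_of_nonneg_left hub (by linarith)
          refine le_of_mul_le_mul_right (a := 1 + x) ?_ (by linarith)
          nlinarith [sq_nonneg (x - 0.515)]
        nlinarith
      · rw [abs_of_nonpos (by linarith : 1 - x ≤ 0)]
        have hmul : exp (1 + η - x) * (x - η) ≤ 1 := by
          calc exp (1 + η - x) * (x - η) ≤ exp (1 + η - x) * exp (x - η - 1) := by
                gcongr
                linarith [add_one_le_exp (x - η - 1)]
            _ = 1 := by rw [← exp_add]; ring_nf; exact exp_zero
        have hub : y * (x - η) ≤ x := by
          calc y * (x - η) ≤ x * exp (1 + η - x) * (x - η) := by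
                gcongr
                linarith
            _ = x * (exp (1 + η - x) * (x - η)) := by ring
            _ ≤ x * 1 := by gcongr
            _ = x := mul_one x
        have hq : (x - 1) * (y * (x - η)) ≤ (x - 1) * x :=
          mul_le_mul_of_nonneg_left hub (by linarith)
        refine le_of_mul_le_mul_right (a := x - η) ?_ (by linarith)
        have : 0 ≤ η * (1 - η) * (1 + η - x) :=
          mul_nonneg (mul_nonneg (by linarith) (by linarith)) (by linarith)
        nlinarith
    · rw [abs_of_nonneg (by linarith : 0 ≤ 1 - y)]
      exact mul_le_mul h (by linarith) (by linarith) (by linarith)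
  · have hx1 : 1 + η < x := by
      rcases lt_abs.mp h with h | h <;> linarith
    have hub : y ≤ 1 + η := by
      calc y ≤ x * exp (1 + η - x) := hle
        _ ≤ ((1 + η) * exp (x - 1 - η)) * exp (1 + η - x) := by
            gcongr
            nlinarith [add_one_le_exp (x - 1 - η)]
        _ = 1 + η := by rw [mul_assoc, ← exp_add]; ring_nf; simp [add_comm]
    have hV : |1 - y| ≤ η := abs_le.mpr ⟨by linarith, by linarith⟩
    rw [max_eq_left hV, max_eq_right h.le, mul_comm]

open Finset in
/-- Exponential decay of `∏ |1 - u i|` for a subsolution `u` of the Ricker map. -/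
lemma prod_abs_one_sub_le {η : ℝ} (hη : 9 / 10 ≤ η) (hη1 : η < 1) {u : ℕ → ℝ}
    (hu : ∀ n, 1 - η ≤ u n) (hstep : ∀ n, u (n + 1) ≤ u n * Real.exp (1 + η - u n)) (n : ℕ) :
    ∏ i ∈ range n, |1 - u i| ≤ max η |1 - u 0| / η * η ^ n := by
  have key : (∏ i ∈ range n, |1 - u i|) * max η |1 - u n| ≤ η ^ n * max η |1 - u 0| := by
    induction n with
    | zero => simp
    | succ n ih =>
      have hP : 0 ≤ ∏ i ∈ range n, |1 - u i| := prod_nonneg fun _ _ => abs_nonneg _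
      have h := abs_one_sub_mul_weight_le hη hη1 (hu n) (hu (n + 1)) (hstep n)
      rw [prod_range_succ, mul_assoc]
      calc _ ≤ (∏ i ∈ range n, |1 - u i|) * (η * max η |1 - u n|) := by gcongr
        _ = η * ((∏ i ∈ range n, |1 - u i|) * max η |1 - u n|) := by ring
        _ ≤ η * (η ^ n * max η |1 - u 0|) := by gcongr
        _ = _ := by ring
  have hη0 : 0 < η := by linarith
  rw [div_mul_eq_mul_div, le_div_iff₀ hη0, mul_comm _ (η ^ n)]
  exact le_trans (by gcongr; exact le_max_left _ _) key


/- Statement 9: Let {a_n} be periodic with period p, 0 < a_n < 2, A = max_{0≤i≤p-1} a_i,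
β = e^{A-1}, α ∈ (0,β].  If all terms of a solution {x_n} lie in [α,β] then there exist
K > 0 and δ ∈ (0,1) with |Π_{i=0}^{n-1} (1-y_i)(1-z_i)| ≤ K δ^n, where y_i = x_{2i} and
z_i = x_{2i-1}.  We index X : ℕ → ℝ with X n = x_{n-1}; thus y_i = X (2i+1), z_i = X (2i). -/
theorem stmt_9 (a : ℕ → ℝ) (p : ℕ) (hp : 0 < p) (hper : Function.Periodic a p)
    (ha : ∀ n : ℕ, 0 < a n ∧ a n < 2)
    (A : ℝ) (hA1 : ∀ i : ℕ, i < p → a i ≤ A) (hA2 : ∃ i : ℕ, i < p ∧ a i = A)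
    (β : ℝ) (hβ : β = Real.exp (A - 1)) (α : ℝ) (hα : 0 < α) (hαβ : α ≤ β)
    (X : ℕ → ℝ)
    (hrec : ∀ n : ℕ, X (n + 2) = X n * Real.exp (a n - X n - X (n + 1)))
    (hin : ∀ n : ℕ, X n ∈ Set.Icc α β) :
    ∃ K δ : ℝ, 0 < K ∧ δ ∈ Set.Ioo (0 : ℝ) 1 ∧
      ∀ n : ℕ, 1 ≤ n →
        |∏ i ∈ Finset.range n, (1 - X (2 * i + 1)) * (1 - X (2 * i))| ≤ K * δ ^ n := by
  obtain ⟨j, -, hj⟩ := hA2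
  have hA : A < 2 := hj ▸ (ha j).2
  have haA : ∀ n, a n ≤ A := fun n => by
    rw [← hper.map_mod_nat n]
    exact hA1 _ (Nat.mod_lt _ hp)
  obtain ⟨η, hη, hη1, hηα, hηA⟩ : ∃ η : ℝ, 9 / 10 ≤ η ∧ η < 1 ∧ 1 - α ≤ η ∧ A - 1 ≤ η :=
    ⟨max (9 / 10) (max (1 - α) (A - 1)), le_max_left _ _,
      max_lt (by norm_num) (max_lt (by linarith) (by linarith)),
      (le_max_left _ _).trans (le_max_right _ _), (le_max_right _ _).trans (le_max_right _ _)⟩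
  have hpos : ∀ n, 0 < X n := fun n => hα.trans_le (hin n).1
  have hlow : ∀ n, 1 - η ≤ X n := fun n => by linarith [(hin n).1]
  have hstep : ∀ n, X (n + 2) ≤ X n * Real.exp (1 + η - X n) := fun n => by
    rw [hrec]
    exact mul_le_mul_of_nonneg_left
      (Real.exp_le_exp.mpr (by linarith [haA n, hpos (n + 1)])) (hpos n).le
  have hodd := prod_abs_one_sub_le hη hη1 (u := fun i => X (2 * i + 1))
    (fun n => hlow _) (fun n => hstep (2 * n + 1))
  have heven := prod_abs_one_sub_le hη hη1 (u := fun i => X (2 * i))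
    (fun n => hlow _) (fun n => hstep (2 * n))
  have hη0 : 0 < η := by linarith
  have hK : ∀ x : ℝ, 0 < max η |1 - x| / η := fun x =>
    div_pos (lt_max_of_lt_left hη0) hη0
  refine ⟨_, η * η, mul_pos (hK (X (2 * 0 + 1))) (hK (X (2 * 0))),
    ⟨by positivity, by nlinarith⟩, fun n _ => ?_⟩
  rw [Finset.prod_mul_distrib, abs_mul, Finset.abs_prod, Finset.abs_prod, mul_pow,
    mul_mul_mul_comm]
  exact mul_le_mul (hodd n) (heven n) (Finset.prod_nonneg fun _ _ => abs_nonneg _)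
    (mul_nonneg (hK _).le (by positivity))
end

section
/- Let {a_n}_{n≥0} be a periodic sequence with 0 < a_n < 2 for all n, let x_0, x_{−1} > 0, and suppose the sequence {t_n} defined by t_0 = x_0/(x_{−1}e^{−x_{−1}}) and t_{n+1} = e^{a_n}/t_n is periodic with period q. Then the solution {x_n} of x_{n+1} = x_{n−1}·exp(a_n − x_{n−1} − x_n) from the initial values x_{−1}, x_0 converges to a periodic solution of period q: there exists a solution {x̄_n} of the same equation with x̄_{n+q} = x̄_n for all n such that |x_n − x̄_n| → 0 as n → ∞. -/
open Real Filter Topology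

/-- A periodic real sequence attains its maximum. -/
lemma exists_forall_le_of_periodic {f : ℕ → ℝ} {p : ℕ} (hp : 0 < p)
    (hf : Function.Periodic f p) : ∃ k, ∀ n, f n ≤ f k := by
  obtain ⟨k, -, hk⟩ := Finset.exists_max_image (Finset.range p) f ⟨0, by simpa using hp⟩
  refine ⟨k, fun n => ?_⟩
  rw [← hf.map_mod_nat n]
  exact hk _ (by simpa using Nat.mod_lt n hp)

lemma exp_one_add_le_four_mul {s : ℝ} (hs0 : 0 ≤ s) (hs1 : s ≤ 1) :
    exp (1 + s) ≤ 4 * (1 + s) := by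
  have hconv := convexOn_exp.2 (Set.mem_univ 0) (Set.mem_univ 1) (sub_nonneg.2 hs1) hs0
    (by ring)
  simp only [smul_eq_mul, mul_zero, mul_one, zero_add, exp_zero] at hconv
  have he := exp_one_lt_d9
  have he1 := exp_one_gt_d9
  rw [exp_add]
  have h : exp 1 * exp s ≤ exp 1 * (1 - s + s * exp 1) := by gcongr
  have he2 : exp 1 * exp 1 ≤ 2.72 * 2.72 := by gcongr <;> linarith
  nlinarith

/-- The Ricker map `x ↦ x exp (2 - x)` at the critical parameter: its logarithmic slope at `x`,
times the one at the image point when that point exceeds `1`, is at most one in absolute value. -/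
lemma mul_exp_two_sub_mul_abs_le {x : ℝ} (hx0 : 0 < x) :
    x * exp (2 - x) * |1 - x| ≤ 1 + |1 - x| := by
  rcases le_total x 1 with h | h
  · rw [abs_of_nonneg (by linarith)]
    have he := exp_one_add_le_four_mul (s := 1 - x) (by linarith) (by linarith)
    rw [show 1 + (1 - x) = 2 - x by ring] at he ⊢
    have hq : x * (1 - x) ≤ 1 / 4 := by nlinarith [sq_nonneg (x - 1 / 2)]
    have : x * (1 - x) * exp (2 - x) ≤ 1 / 4 * (4 * (2 - x)) := by gcongr
    linarith
  · rw [abs_of_nonpos (by linarith)]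
    have he : x - 1 ≤ exp (x - 2) := by linarith [add_one_le_exp (x - 2)]
    have : (x - 1) * exp (2 - x) ≤ exp (x - 2) * exp (2 - x) := by gcongr
    rw [← exp_add, show x - 2 + (2 - x) = 0 by ring, exp_zero] at this
    nlinarith

/-- Along an orbit with positive entries, the product of three consecutive logarithmic slopes is
dominated by a fixed fraction of a shorter product. -/
lemma triple_slope_le {x y z A δ : ℝ} (hx : 0 < x) (hy : 0 < y) (hA : A < 2)
    (hz : z ≤ x * exp (A - x)) (hyz : y * z ≤ 1) (hδ : δ ≤ z) :
    let r := max (exp (A - 2)) (1 - δ)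
    |1 - x| * |1 - y| * |1 - z| ≤ r ∨
      |1 - x| * |1 - y| * |1 - z| ≤ r * (|1 - x| * |1 - y|) := by
  intro r
  have hr1 : exp (A - 2) ≤ r := le_max_left _ _
  have hr2 : 1 - δ ≤ r := le_max_right _ _
  have hε : exp (A - 2) < 1 := (exp_lt_one_iff.2 (by linarith))
  have hε0 := exp_pos (A - 2)
  rcases le_total z 1 with h1 | h1
  · right
    rw [abs_of_nonneg (by linarith : 0 ≤ 1 - z), mul_comm]
    gcongr
    linarith
  have hy1 : y ≤ 1 := by nlinarith
  have hyabs : |1 - y| ≤ 1 := by rw [abs_of_nonneg] <;> linarith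
  have hzabs : |1 - z| = z - 1 := by rw [abs_of_nonpos] <;> linarith
  have hred : |1 - x| * |1 - y| * |1 - z| ≤ |1 - x| * (z - 1) := by
    rw [hzabs]
    have : |1 - x| * |1 - y| ≤ |1 - x| * 1 := by gcongr
    rw [mul_one] at this
    exact mul_le_mul_of_nonneg_right this (by linarith)
  have hsplit : exp (A - x) = exp (2 - x) * exp (A - 2) := by rw [← exp_add]; congr 1; ring
  rw [hsplit] at hz
  left
  have hmain := mul_exp_two_sub_mul_abs_le hx
  have h3 : |1 - x| * z ≤ |1 - x| * (x * (exp (2 - x) * exp (A - 2))) := by gcongr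
  have h4 : x * exp (2 - x) * |1 - x| * exp (A - 2) ≤ (1 + |1 - x|) * exp (A - 2) := by gcongr
  nlinarith [abs_nonneg (1 - x)]

/-- Two steps of the maps `x ↦ t n * x * exp (-x)`. -/
lemma orbit_two_step {t a x : ℕ → ℝ} (hta : ∀ n, t n * t (n + 1) = exp (a n))
    (hx : ∀ n, x (n + 1) = t n * x n * exp (-x n)) (n : ℕ) :
    x (n + 2) = x n * exp (a n - x n - x (n + 1)) := by
  rw [hx (n + 1), sub_sub, sub_eq_add_neg, exp_add, ← hta, neg_add, exp_add]
  nth_rewrite 1 [hx n]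
  ring

/-- Uniform persistence: orbits of `x ↦ t n * x * exp (-x)` stay away from zero. -/
lemma orbit_lower_bound {t a x : ℕ → ℝ} {T B α δ : ℝ} (htpos : ∀ n, 0 < t n)
    (htT : ∀ n, t n ≤ T) (hta : ∀ n, t n * t (n + 1) = exp (a n)) (hα : ∀ n, α ≤ a n)
    (hα0 : 0 < α) (hxpos : ∀ n, 0 < x n) (hxB : ∀ n, x n ≤ B)
    (hx : ∀ n, x (n + 1) = t n * x n * exp (-x n))
    (h0 : δ ≤ x 0) (h1 : δ ≤ x 1) (hδ : δ ≤ α / (1 + T) * exp (-(2 * B))) (n : ℕ) :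
    δ ≤ x n := by
  have hT : 0 < T := (htpos 0).trans_le (htT 0)
  suffices h : δ ≤ x n ∧ δ ≤ x (n + 1) from h.1
  induction n with
  | zero => exact ⟨h0, h1⟩
  | succ n ih =>
    refine ⟨ih.2, ?_⟩
    rw [orbit_two_step hta hx n]
    rcases le_total (x n) (α / (1 + T)) with h | h
    · have h3 : x (n + 1) ≤ T * x n := by
        rw [hx n]
        have : exp (-x n) ≤ 1 := exp_le_one_iff.2 (by linarith [hxpos n])
        calc t n * x n * exp (-x n) ≤ T * x n * 1 := by
              have := hxpos n
              have := htT n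
              gcongr
          _ = T * x n := mul_one _
      rw [le_div_iff₀ (by linarith)] at h
      have h4 : 1 ≤ exp (a n - x n - x (n + 1)) := one_le_exp (by linarith [hα n])
      nlinarith [hxpos n, ih.1]
    · refine hδ.trans ?_
      have h3 : -(2 * B) ≤ a n - x n - x (n + 1) := by linarith [hα n, hxB n, hxB (n + 1)]
      have := hxpos n
      gcongr

/-- The orbit, in logarithmic coordinates, of the maps `x ↦ t n * x * exp (-x)`. -/
noncomputable def logFlow (t : ℕ → ℝ) : ℕ → ℝ → ℝ
  | 0, u => u
  | n + 1, u => logFlow t n u + log (t n) - exp (logFlow t n u)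

/-- The derivative of `logFlow` in the initial value. -/
noncomputable def logFlowDeriv (t : ℕ → ℝ) : ℕ → ℝ → ℝ
  | 0, _ => 1
  | n + 1, u => logFlowDeriv t n u * (1 - exp (logFlow t n u))

lemma hasDerivAt_logFlow (t : ℕ → ℝ) (n : ℕ) (u : ℝ) :
    HasDerivAt (logFlow t n) (logFlowDeriv t n u) u := by
  induction n with
  | zero => exact hasDerivAt_id u
  | succ n ih =>
    have h : HasDerivAt (logFlow t (n + 1)) _ u := (ih.add_const (log (t n))).sub ih.exp
    convert h using 1
    simp only [logFlowDeriv]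
    ring

lemma exp_logFlow_succ {t : ℕ → ℝ} (htpos : ∀ n, 0 < t n) (n : ℕ) (u : ℝ) :
    exp (logFlow t (n + 1) u) =
      t n * exp (logFlow t n u) * exp (-exp (logFlow t n u)) := by
  simp only [logFlow]
  rw [sub_eq_add_neg, exp_add, exp_add, exp_log (htpos n)]
  ring

lemma logFlow_log {t x : ℕ → ℝ} (htpos : ∀ n, 0 < t n) (hxpos : ∀ n, 0 < x n)
    (hx : ∀ n, x (n + 1) = t n * x n * exp (-x n)) (n : ℕ) :
    logFlow t n (log (x 0)) = log (x n) := by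
  induction n with
  | zero => rfl
  | succ n ih =>
    simp only [logFlow]
    rw [ih, exp_log (hxpos n), hx n,
      log_mul (mul_pos (htpos n) (hxpos n)).ne' (exp_pos _).ne',
      log_mul (htpos n).ne' (hxpos n).ne', log_exp]
    ring

/-- On a bounded set of initial values the derivatives of `logFlow` decay geometrically. -/
lemma exists_logFlowDeriv_le {t a : ℕ → ℝ} {T A α : ℝ} (htpos : ∀ n, 0 < t n)
    (htT : ∀ n, t n ≤ T) (hta : ∀ n, t n * t (n + 1) = exp (a n)) (hα : ∀ n, α ≤ a n)
    (hα0 : 0 < α) (hA : ∀ n, a n ≤ A) (hA2 : A < 2) (l m : ℝ) :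
    ∃ C s : ℝ, 0 < s ∧ s < 1 ∧ ∀ u ∈ Set.Icc l m, ∀ n, |logFlowDeriv t n u| ≤ C * s ^ n := by
  have hT : 0 < T := (htpos 0).trans_le (htT 0)
  set B := T + exp m with hB
  have hB0 : 0 < B := by positivity
  set δ := min (exp l) (min (t 0 * exp l * exp (-exp m)) (α / (1 + T) * exp (-(2 * B)))) with hδ
  have hδ0 : 0 < δ := by have := htpos 0; positivity
  set r := max (exp (A - 2)) (1 - δ) with hr
  have hr0 : 0 < r := (exp_pos _).trans_le (le_max_left _ _)
  have hr1 : r < 1 := max_lt ((exp_lt_one_iff.2 (by linarith))) (by linarith)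
  set s := (2 + r) / 3 with hs
  have hs0 : 0 < s := by positivity
  have hs1 : s < 1 := by linarith
  have hs3 : r ≤ s ^ 3 := by
    have : s ^ 3 - r = (1 - r) ^ 2 * (8 + r) / 27 := by rw [hs]; ring
    nlinarith [show 0 ≤ (1 - r) ^ 2 * (8 + r) / 27 by positivity]
  refine ⟨(1 + B) ^ 2 / s ^ 2, s, hs0, hs1, fun u hu => ?_⟩
  set x : ℕ → ℝ := fun n => exp (logFlow t n u) with hxdef
  have hxpos : ∀ n, 0 < x n := fun n => exp_pos _
  have hx : ∀ n, x (n + 1) = t n * x n * exp (-x n) := fun n => exp_logFlow_succ htpos n u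
  have hx0l : exp l ≤ x 0 := exp_le_exp.2 hu.1
  have hx0m : x 0 ≤ exp m := exp_le_exp.2 hu.2
  have hxe : ∀ n, x (n + 1) ≤ t n * exp (-1) := fun n => by
    rw [hx, mul_assoc]
    exact mul_le_mul_of_nonneg_left (mul_exp_neg_le_exp_neg_one _) (htpos n).le
  have hxB : ∀ n, x n ≤ B := by
    rintro (_ | n)
    · linarith
    · have h1 : exp (-1) ≤ 1 := exp_le_one_iff.2 (by norm_num)
      have h2 : t n * exp (-1) ≤ t n * 1 := mul_le_mul_of_nonneg_left h1 (htpos n).le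
      linarith [hxe n, htT n, exp_pos m]
  have hxδ : ∀ n, δ ≤ x n := by
    refine orbit_lower_bound htpos htT hta hα hα0 hxpos hxB hx ((min_le_left _ _).trans hx0l)
      (((min_le_right _ _).trans (min_le_left _ _)).trans ?_)
      ((min_le_right _ _).trans (min_le_right _ _))
    rw [hx 0]
    have := htpos 0
    gcongr
  have hprod : ∀ n, x (n + 1) * x (n + 2) ≤ 1 := fun n => by
    calc x (n + 1) * x (n + 2) ≤ (t n * exp (-1)) * (t (n + 1) * exp (-1)) :=
          mul_le_mul (hxe n) (hxe (n + 1)) (hxpos _).le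
            (mul_pos (htpos n) (exp_pos _)).le
      _ = exp (a n - 2) := by
          rw [show a n - 2 = a n + (-1 + -1) by ring, exp_add, exp_add, ← hta]; ring
      _ ≤ 1 := exp_le_one_iff.2 (by linarith [hA n])
  have hstep : ∀ n, x (n + 2) ≤ x n * exp (A - x n) := fun n => by
    rw [orbit_two_step hta hx n]
    have := hxpos n
    have : a n - x n - x (n + 1) ≤ A - x n := by linarith [hxpos (n + 1), hA n]
    gcongr
  have hslope : ∀ n, |1 - x n| ≤ 1 + B := fun n => by
    rw [abs_le]; constructor <;> linarith [hxpos n, hxB n]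
  set D : ℕ → ℝ := fun n => |logFlowDeriv t n u| with hD
  have hDsucc : ∀ n, D (n + 1) = D n * |1 - x n| := fun n => by
    simp only [hD, logFlowDeriv, abs_mul, hxdef]
  have hDnn : ∀ n, 0 ≤ D n := fun n => abs_nonneg _
  set C := (1 + B) ^ 2 / s ^ 2 with hC
  have hC0 : 0 < C := by positivity
  have hCs : C * s ^ 2 = (1 + B) ^ 2 := by rw [hC]; field_simp
  suffices h : ∀ n, D n ≤ C * s ^ n ∧ D (n + 1) ≤ C * s ^ (n + 1) ∧
      D (n + 2) ≤ C * s ^ (n + 2) from fun n => (h n).1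
  intro n
  induction n with
  | zero =>
    have hD0 : D 0 = 1 := by simp [hD, logFlowDeriv]
    have hD1 : D 1 ≤ 1 + B := by rw [hDsucc 0, hD0, one_mul]; exact hslope 0
    have hD2 : D 2 ≤ (1 + B) ^ 2 := by
      rw [hDsucc 1, sq]
      exact mul_le_mul hD1 (hslope 1) (abs_nonneg _) (by linarith)
    have hs21 : s ^ 2 ≤ s := by nlinarith
    have hBB : 1 + B ≤ (1 + B) ^ 2 := by nlinarith
    have hC1 : C * s ^ 2 ≤ C * s := by gcongr
    have hC2 : C * s ≤ C := by nlinarith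
    simp only [zero_add, pow_zero, pow_one, mul_one]
    exact ⟨by linarith, by linarith, by linarith⟩
  | succ n ih =>
    refine ⟨ih.2.1, ih.2.2, ?_⟩
    have hD1 := hDsucc n
    have hD2 : D (n + 2) = D n * (|1 - x n| * |1 - x (n + 1)|) := by
      rw [hDsucc (n + 1), hD1, mul_assoc]
    have hD3 : D (n + 1 + 2) =
        D n * (|1 - x n| * |1 - x (n + 1)| * |1 - x (n + 2)|) := by
      rw [show n + 1 + 2 = n + 2 + 1 by ring, hDsucc (n + 2), hD2, mul_assoc]
    have hsn : ∀ k, n ≤ k → r * (C * s ^ k) ≤ C * s ^ (n + 1 + 2) := fun k hk => by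
      calc r * (C * s ^ k) ≤ s ^ 3 * (C * s ^ n) := by
            have : s ^ k ≤ s ^ n := pow_le_pow_of_le_one hs0.le hs1.le hk
            gcongr
        _ = C * s ^ (n + 1 + 2) := by ring
    have htrip := triple_slope_le (hxpos n) (hxpos (n + 1)) hA2 (hstep n) (hprod n) (hxδ (n + 2))
    rw [hD3]
    rcases htrip with h | h
    · refine le_trans ?_ (hsn n le_rfl)
      calc _ ≤ D n * r := mul_le_mul_of_nonneg_left h (hDnn n)
        _ = r * D n := mul_comm _ _
        _ ≤ _ := mul_le_mul_of_nonneg_left ih.1 hr0.le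
    · refine le_trans ?_ (hsn (n + 2) (by omega))
      calc _ ≤ D n * (r * (|1 - x n| * |1 - x (n + 1)|)) :=
            mul_le_mul_of_nonneg_left h (hDnn n)
        _ = r * D (n + 2) := by rw [hD2]; ring
        _ ≤ _ := mul_le_mul_of_nonneg_left ih.2.2 hr0.le

/-- A sequence whose increments over `q` steps decay geometrically is asymptotic to a
`q`-periodic sequence, which is the limit along arithmetic progressions. -/
lemma exists_periodic_limit {V : ℕ → ℝ} {K s : ℝ} {q : ℕ} (hq : 0 < q) (hs0 : 0 < s)
    (hs1 : s < 1) (hV : ∀ n, |V (n + q) - V n| ≤ K * s ^ n) :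
    ∃ W : ℕ → ℝ, (∀ n, W (n + q) = W n) ∧
      (∀ n, Tendsto (fun m => V (n + m * q)) atTop (𝓝 (W n))) ∧
      Tendsto (fun n => W n - V n) atTop (𝓝 0) := by
  have hsq : s ^ q < 1 := pow_lt_one₀ hs0.le hs1 hq.ne'
  have hgeo : ∀ n m, dist (V (n + m * q)) (V (n + (m + 1) * q)) ≤ K * s ^ n * (s ^ q) ^ m := by
    intro n m
    rw [dist_comm, Real.dist_eq, show n + (m + 1) * q = n + m * q + q by ring]
    refine (hV _).trans_eq ?_
    rw [pow_add, mul_comm m q, pow_mul, mul_assoc]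
  have hlim : ∀ n, ∃ w, Tendsto (fun m => V (n + m * q)) atTop (𝓝 w) := fun n =>
    cauchySeq_tendsto_of_complete (cauchySeq_of_le_geometric _ _ hsq (hgeo n))
  choose W hW using hlim
  refine ⟨W, fun n => ?_, hW, ?_⟩
  · refine tendsto_nhds_unique (hW (n + q)) ?_
    refine ((tendsto_add_atTop_iff_nat 1).2 (hW n)).congr fun m => ?_
    congr 1
    ring
  · refine squeeze_zero_norm (a := fun n => K * s ^ n / (1 - s ^ q)) (fun n => ?_) ?_
    · have h := dist_le_of_le_geometric_of_tendsto₀ _ _ hsq (hgeo n) (hW n)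
      rw [dist_comm, Real.dist_eq] at h
      simpa using h
    · have h := ((tendsto_pow_atTop_nhds_zero_of_lt_one hs0.le hs1).const_mul K).div_const
        (1 - s ^ q)
      simpa using h

/- Statement 10 (Theorem per): {a_n} periodic with 0 < a_n < 2, x_{-1}, x_0 > 0, and the
factor sequence {t_n} periodic with period q.  Then the solution {x_n} converges to a
periodic solution of period q: there is a solution {x̄_n} of the same equation with
x̄_{n+q} = x̄_n and |x_n - x̄_n| → 0.  We index X : ℕ → ℝ with X n = x_{n-1}. -/
theorem stmt_10 (a : ℕ → ℝ) (p : ℕ) (hp : 0 < p) (hper : Function.Periodic a p)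
    (ha : ∀ n : ℕ, 0 < a n ∧ a n < 2)
    (X t : ℕ → ℝ) (hx0 : 0 < X 0) (hx1 : 0 < X 1)
    (hrec : ∀ n : ℕ, X (n + 2) = X n * Real.exp (a n - X n - X (n + 1)))
    (ht0 : t 0 = X 1 / (X 0 * Real.exp (-X 0)))
    (htrec : ∀ n : ℕ, t (n + 1) = Real.exp (a n) / t n)
    (q : ℕ) (hq : 0 < q) (htq : ∀ n : ℕ, t (n + q) = t n) :
    ∃ Y : ℕ → ℝ,
      (∀ n : ℕ, Y (n + 2) = Y n * Real.exp (a n - Y n - Y (n + 1))) ∧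
      (∀ n : ℕ, Y (n + q) = Y n) ∧
      Filter.Tendsto (fun n => |X n - Y n|) Filter.atTop (nhds 0) := by
  have hXpos : ∀ n, 0 < X n := by
    intro n
    suffices h : 0 < X n ∧ 0 < X (n + 1) from h.1
    induction n with
    | zero => exact ⟨hx0, hx1⟩
    | succ n ih => exact ⟨ih.2, by rw [hrec n]; exact mul_pos ih.1 (exp_pos _)⟩
  have htpos : ∀ n, 0 < t n := by
    intro n
    induction n with
    | zero => rw [ht0]; positivity
    | succ n ih => rw [htrec]; positivity
  have hta : ∀ n, t n * t (n + 1) = exp (a n) := fun n => by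
    rw [htrec, mul_div_cancel₀ _ (htpos n).ne']
  have hX : ∀ n, X (n + 1) = t n * X n * exp (-X n) := by
    intro n
    induction n with
    | zero =>
      rw [ht0]
      field_simp
    | succ n ih =>
      have h := htpos n
      calc X (n + 1 + 1) = X n * (exp (a n) * (exp (-X n) * exp (-X (n + 1)))) := by
            rw [hrec n, sub_sub, sub_eq_add_neg, exp_add, neg_add, exp_add]
        _ = exp (a n) / t n * (t n * X n * exp (-X n)) * exp (-X (n + 1)) := by field_simp
        _ = t (n + 1) * X (n + 1) * exp (-X (n + 1)) := by rw [htrec, ← ih]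
  have haq : ∀ n, a (n + q) = a n := fun n => by
    rw [← exp_eq_exp, ← hta, ← hta, htq, show n + q + 1 = n + 1 + q by ring, htq]
  obtain ⟨kA, hA⟩ := exists_forall_le_of_periodic hp hper
  obtain ⟨kα, hα⟩ := exists_forall_le_of_periodic (f := fun n => -a n) hp
    (fun n => by simp only [hper n])
  obtain ⟨kT, hT⟩ := exists_forall_le_of_periodic hq htq
  obtain ⟨C, s, hs0, hs1, hC⟩ := exists_logFlowDeriv_le htpos hT hta
    (fun n => neg_le_neg_iff.1 (hα n)) (ha kα).1 hA (ha kA).2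
    (min (log (X 0)) (log (X q))) (max (log (X 0)) (log (X q)))
  have hshift : ∀ n, logFlow t n (log (X q)) = log (X (n + q)) := fun n => by
    have h := logFlow_log (x := fun n => X (n + q)) htpos (fun n => hXpos _)
      (fun n => by rw [show n + 1 + q = n + q + 1 by ring, hX, htq]) n
    simpa using h
  have hV : ∀ n, |log (X (n + q)) - log (X n)| ≤ C * |log (X q) - log (X 0)| * s ^ n := by
    intro n
    have h := (convex_Icc (min (log (X 0)) (log (X q)))
      (max (log (X 0)) (log (X q)))).norm_image_sub_le_of_norm_hasDerivWithin_le
      (fun u _ => (hasDerivAt_logFlow t n u).hasDerivWithinAt) (fun u hu => hC u hu n)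
      ⟨min_le_left _ _, le_max_left _ _⟩ ⟨min_le_right _ _, le_max_right _ _⟩
    rw [hshift, logFlow_log htpos hXpos hX] at h
    simp only [Real.norm_eq_abs] at h
    linarith
  obtain ⟨W, hWq, hW, hWV⟩ := exists_periodic_limit (V := fun n => log (X n)) hq hs0 hs1 hV
  have hlim : ∀ n, Tendsto (fun m => X (n + m * q)) atTop (𝓝 (exp (W n))) := fun n =>
    ((continuous_exp.tendsto _).comp (hW n)).congr fun m => exp_log (hXpos _)
  refine ⟨fun n => exp (W n), fun n => ?_, fun n => by simp only [hWq], ?_⟩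
  · refine tendsto_nhds_unique (hlim (n + 2)) ?_
    have h := (hlim n).mul ((continuous_exp.tendsto _).comp
      (((hlim n).const_sub (a n)).sub (hlim (n + 1))))
    refine h.congr fun m => ?_
    have ham : a (n + m * q) = a n := by
      have h : Function.Periodic a q := haq
      simpa using h.nat_mul m n
    simp only [Function.comp]
    rw [show n + 2 + m * q = n + m * q + 2 by ring, hrec, ham,
      show n + 1 + m * q = n + m * q + 1 by ring]
  · have hbound : ∀ n, X (n + 1) ≤ t kT := fun n => by
      rw [hX, mul_assoc]
      have h1 : X n * exp (-X n) ≤ 1 :=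
        (mul_exp_neg_le_exp_neg_one _).trans (exp_le_one_iff.2 (by norm_num))
      nlinarith [htpos n, hT n]
    have hexp : Tendsto (fun n => t kT * |1 - exp (W n - log (X n))|) atTop (𝓝 0) := by
      have h := ((((continuous_exp.tendsto _).comp hWV).const_sub 1).abs).const_mul (t kT)
      simpa using h
    refine (tendsto_add_atTop_iff_nat 1).1 ?_
    refine squeeze_zero (fun n => abs_nonneg _) (fun n => ?_)
      ((tendsto_add_atTop_iff_nat 1).2 hexp)
    have hpos := hXpos (n + 1)
    have hfac : X (n + 1) - exp (W (n + 1)) =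
        X (n + 1) * (1 - exp (W (n + 1) - log (X (n + 1)))) := by
      rw [exp_sub, exp_log hpos]
      field_simp
    rw [hfac, abs_mul, abs_of_pos hpos]
    exact mul_le_mul_of_nonneg_right (hbound n) (abs_nonneg _)
end

section
/- Let {a_n}_{n≥0} be periodic with minimal odd period p and 0 < a_i < 2 for i = 0, …, p−1. Then every solution {x_n} of x_{n+1} = x_{n−1}·exp(a_n − x_{n−1} − x_n) with initial values x_{−1}, x_0 > 0 converges to a periodic solution of period 2p (depending on the initial values): there exists a solution {x̄_n} with x̄_{n+2p} = x̄_n for all n such that |x_n − x̄_n| → 0 as n → ∞. -/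
open Real Filter Topology Finset

/-- In the logarithmic variable, the Ricker recursion `x ↦ x * exp (u n - x)` started at `η`. -/
noncomputable def logRicker (u : ℕ → ℝ) (η : ℝ) : ℕ → ℝ
  | 0 => η
  | n + 1 => logRicker u η n + u n - exp (logRicker u η n)

theorem logRicker_hasDerivAt (u : ℕ → ℝ) (η : ℝ) (n : ℕ) :
    HasDerivAt (fun t => logRicker u t n) (∏ k ∈ range n, (1 - exp (logRicker u η k))) η := by
  induction n with
  | zero => simpa [logRicker] using hasDerivAt_id' η
  | succ n ih =>
    have h := (ih.add_const (u n)).sub ih.exp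
    rw [prod_range_succ]
    refine h.congr_deriv ?_
    ring

theorem exp_logRicker_succ (u : ℕ → ℝ) (η : ℝ) (n : ℕ) :
    exp (logRicker u η (n + 1)) =
      exp (logRicker u η n) * exp (u n - exp (logRicker u η n)) := by
  rw [← exp_add, logRicker]
  congr 1
  ring

theorem logRicker_log_eq {u X : ℕ → ℝ} (hX : ∀ n, 0 < X n)
    (hu : ∀ n, X (n + 1) = X n * exp (u n - X n)) (n : ℕ) :
    logRicker u (log (X 0)) n = log (X n) := by
  induction n with
  | zero => rfl
  | succ n ih =>
    rw [logRicker, ih, hu n, log_mul (hX n).ne' (exp_pos _).ne', log_exp, exp_log (hX n)]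
    ring

theorem abs_one_sub_mul_ricker_sub_one_le {y : ℝ} (hy : 0 < y) :
    |1 - y| * (y * exp (2 - y) - 1) ≤ 1 := by
  rcases le_total y 1 with h | h
  · rw [abs_of_nonneg (by linarith)]
    have h1 : exp (2 - y) * (1 + y) ≤ 7.4 := by
      have h2 : exp (2 - y) * exp y = exp 1 * exp 1 := by
        rw [← exp_add, ← exp_add]; congr 1; ring
      have h3 := exp_one_lt_d9
      have h4 : exp 1 * exp 1 ≤ 7.4 := by nlinarith [exp_pos 1]
      nlinarith [add_one_le_exp y, exp_pos (2 - y)]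
    have h5 : y * (1 - y) * (exp (2 - y) * (1 + y)) ≤ y * (1 - y) * 7.4 :=
      mul_le_mul_of_nonneg_left h1 (mul_nonneg hy.le (by linarith))
    have h6 : y * (1 - y) * exp (2 - y) ≤ 2 - y := by
      refine le_of_mul_le_mul_right ?_ (by linarith : (0 : ℝ) < 1 + y)
      nlinarith [sq_nonneg (y - 1 / 2)]
    nlinarith
  · rw [abs_of_nonpos (by linarith)]
    have h1 : exp (2 - y) * exp (y - 2) = 1 := by rw [← exp_add]; simp
    have h2 : exp (2 - y) * (y - 1) ≤ 1 := by
      nlinarith [add_one_le_exp (y - 2), exp_pos (2 - y)]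
    nlinarith

theorem mul_exp_neg_le_one_s11 (y : ℝ) : y * exp (-y) ≤ 1 := by
  have h1 : exp y * exp (-y) = 1 := by rw [← exp_add]; simp
  nlinarith [add_one_le_exp y, exp_pos (-y)]

/-- Weight of the logarithmic metric in which the second-order recursion contracts. -/
noncomputable def contractionWeight (lam x y : ℝ) : ℝ :=
  max (max 1 (lam * (y - 1))) (lam ^ 2 * |1 - y| * (x * exp (2 - x - y) - 1))

theorem one_le_contractionWeight (lam x y : ℝ) : 1 ≤ contractionWeight lam x y :=
  (le_max_left _ _).trans (le_max_left _ _)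

theorem contractionWeight_le {lam x y M : ℝ} (hlam : 1 ≤ lam) (hx : 0 < x) (hy : 0 < y)
    (hxM : x ≤ M) (hyM : y ≤ M) :
    contractionWeight lam x y ≤ lam ^ 2 * (1 + M) * (1 + M * exp 2) := by
  have hM : 0 < M := hx.trans_le hxM
  have he := exp_pos 2
  have hMe : 0 < M * exp 2 := mul_pos hM he
  have hl : lam ≤ lam ^ 2 := by nlinarith
  have hbig : lam ^ 2 * (1 + M) ≤ lam ^ 2 * (1 + M) * (1 + M * exp 2) :=
    le_mul_of_one_le_right (by positivity) (by linarith)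
  refine max_le (max_le (le_trans ?_ hbig) (le_trans ?_ hbig)) ?_
  · nlinarith
  · nlinarith
  · have h1 : |1 - y| ≤ 1 + M := abs_le.2 ⟨by linarith, by linarith⟩
    have h2 : x * exp (2 - x - y) ≤ M * exp 2 :=
      mul_le_mul hxM (exp_le_exp.2 (by linarith)) (exp_pos _).le hM.le
    calc lam ^ 2 * |1 - y| * (x * exp (2 - x - y) - 1)
        ≤ lam ^ 2 * |1 - y| * (1 + M * exp 2) :=
          mul_le_mul_of_nonneg_left (by linarith) (by positivity)
      _ ≤ _ := by gcongr

theorem contractionWeight_step {c x y z : ℝ} (hc : 0 < c) (hx : 0 < x) (hy : c ≤ y) (hz : c ≤ z)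
    (hzx : z ≤ x * exp (2 - x - y)) :
    exp (c / 3) * |1 - y| * contractionWeight (exp (c / 3)) y z
      ≤ contractionWeight (exp (c / 3)) x y := by
  set lam := exp (c / 3) with hlam
  have hl1 : 1 ≤ lam := one_le_exp (by positivity)
  have hl3 : lam ^ 3 * exp (-c) = 1 := by
    rw [hlam, ← exp_nat_mul, ← exp_add]; norm_num; ring
  have hlc : lam ^ 3 * (1 - c) ≤ 1 := by
    nlinarith [add_one_le_exp (-c), pow_pos (zero_lt_one.trans_le hl1) 3]
  have hA : 1 ≤ contractionWeight lam x y := one_le_contractionWeight _ _ _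
  have hB : lam * (y - 1) ≤ contractionWeight lam x y :=
    (le_max_right _ _).trans (le_max_left _ _)
  have hC : lam ^ 2 * |1 - y| * (x * exp (2 - x - y) - 1) ≤ contractionWeight lam x y :=
    le_max_right _ _
  have habs := abs_nonneg (1 - y)
  have hl0 : 0 < lam := by linarith
  have hl31 : 1 ≤ lam ^ 3 := one_le_pow₀ hl1
  have hl2 : lam ≤ lam ^ 3 := by nlinarith [mul_pos hl0 hl0]
  have hexp : y * exp (2 - y - z) = y * exp (2 - y) * exp (-z) := by
    rw [mul_assoc, ← exp_add]; ring_nf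
  conv_lhs => rw [contractionWeight]
  rw [mul_max_of_nonneg _ _ (by positivity), mul_max_of_nonneg _ _ (by positivity)]
  refine max_le (max_le ?_ ?_) ?_
  · rcases le_total y 1 with h | h
    · rw [abs_of_nonneg (by linarith)]
      have : lam * (1 - y) ≤ lam ^ 3 * (1 - c) :=
        mul_le_mul hl2 (by linarith) (by linarith) (by positivity)
      linarith
    · rw [abs_of_nonpos (by linarith)]
      linarith
  · refine le_trans ?_ hC
    have : lam ^ 2 * |1 - y| * (z - 1) ≤ lam ^ 2 * |1 - y| * (x * exp (2 - x - y) - 1) :=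
      mul_le_mul_of_nonneg_left (by linarith) (by positivity)
    linarith
  · rcases le_total (y * exp (2 - y - z)) 1 with hneg | hpos
    · have : lam * |1 - y| * (lam ^ 2 * |1 - z| * (y * exp (2 - y - z) - 1)) ≤ 0 :=
        mul_nonpos_of_nonneg_of_nonpos (by positivity)
          (mul_nonpos_of_nonneg_of_nonpos (by positivity) (by linarith))
      linarith
    have hy0 : 0 < y := by linarith
    have hez : exp (-z) ≤ exp (-c) := exp_le_exp.2 (by linarith)
    have hec : exp (-c) ≤ 1 := exp_le_one_iff.2 (by linarith)
    rcases le_total y 2 with h2 | h2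
    · have hz2 : z ≤ 2 := by
        by_contra! hz2
        have h3 : y * exp (2 - y - z) < y * exp (-y) :=
          mul_lt_mul_of_pos_left (exp_lt_exp.2 (by linarith)) hy0
        linarith [mul_exp_neg_le_one_s11 y]
      have hz1 : |1 - z| ≤ 1 := abs_le.2 ⟨by linarith, by linarith⟩
      have hkey := abs_one_sub_mul_ricker_sub_one_le hy0
      have h4 : y * exp (2 - y - z) - 1 ≤ exp (-c) * (y * exp (2 - y) - 1) := by
        have : y * exp (2 - y) * exp (-z) ≤ y * exp (2 - y) * exp (-c) :=
          mul_le_mul_of_nonneg_left hez (by positivity)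
        rw [hexp]; linarith
      have h5 : |1 - z| * (y * exp (2 - y - z) - 1) ≤ exp (-c) * (y * exp (2 - y) - 1) :=
        (mul_le_of_le_one_left (by linarith) hz1).trans h4
      calc lam * |1 - y| * (lam ^ 2 * |1 - z| * (y * exp (2 - y - z) - 1))
          = lam ^ 3 * |1 - y| * (|1 - z| * (y * exp (2 - y - z) - 1)) := by ring
        _ ≤ lam ^ 3 * |1 - y| * (exp (-c) * (y * exp (2 - y) - 1)) :=
            mul_le_mul_of_nonneg_left h5 (by positivity)
        _ = (lam ^ 3 * exp (-c)) * (|1 - y| * (y * exp (2 - y) - 1)) := by ring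
        _ ≤ 1 := by rw [hl3, one_mul]; exact hkey
        _ ≤ _ := hA
    · have hz1 : z ≤ 1 := by
        have h3 : x * exp (2 - x - y) ≤ x * exp (-x) :=
          mul_le_mul_of_nonneg_left (exp_le_exp.2 (by linarith)) hx.le
        linarith [mul_exp_neg_le_one_s11 x]
      have h4 : y * exp (2 - y - z) - 1 ≤ 1 := by
        have h5 : exp (2 - y - z) ≤ exp (2 - y) := exp_le_exp.2 (by linarith)
        have h6 : exp (2 - y) * exp (y - 2) = 1 := by rw [← exp_add]; simp
        have h7 : exp (2 - y) * (y - 1) ≤ 1 := by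
          nlinarith [add_one_le_exp (y - 2), exp_pos (2 - y)]
        nlinarith [exp_pos (2 - y)]
      rw [abs_of_nonneg (by linarith : 0 ≤ 1 - z), abs_of_nonpos (by linarith : 1 - y ≤ 0)]
      have h5 : (1 - z) * (y * exp (2 - y - z) - 1) ≤ 1 - c :=
        (mul_le_of_le_one_right (by linarith) h4).trans (by linarith)
      have hy1 : 0 ≤ y - 1 := by linarith
      calc lam * -(1 - y) * (lam ^ 2 * (1 - z) * (y * exp (2 - y - z) - 1))
          = lam ^ 3 * (y - 1) * ((1 - z) * (y * exp (2 - y - z) - 1)) := by ring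
        _ ≤ lam ^ 3 * (y - 1) * (1 - c) := mul_le_mul_of_nonneg_left h5 (by positivity)
        _ = lam ^ 3 * (1 - c) * (y - 1) := by ring
        _ ≤ 1 * (y - 1) := mul_le_mul_of_nonneg_right hlc hy1
        _ ≤ lam * (y - 1) := mul_le_mul_of_nonneg_right hl1 hy1
        _ ≤ _ := hB

theorem ricker_two_step {u x : ℕ → ℝ} (hu : ∀ n, x (n + 1) = x n * exp (u n - x n)) (n : ℕ) :
    x (n + 2) = x n * exp (u n + u (n + 1) - x n - x (n + 1)) := by
  have h : x (n + 2) = x (n + 1) * exp (u (n + 1) - x (n + 1)) := hu (n + 1)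
  rw [h, show u n + u (n + 1) - x n - x (n + 1) = (u n - x n) + (u (n + 1) - x (n + 1)) by ring,
    exp_add, ← mul_assoc, ← hu n]

theorem ricker_le {u x : ℕ → ℝ} {U M : ℝ} (hU : ∀ n, |u n| ≤ U)
    (hu : ∀ n, x (n + 1) = x n * exp (u n - x n)) (h0 : x 0 ≤ M) (hM : exp U ≤ M) (n : ℕ) :
    x n ≤ M := by
  rcases n with _ | n
  · exact h0
  · rw [hu n, show u n - x n = -x n + u n by ring, exp_add, ← mul_assoc]
    refine le_trans ?_ hM
    have h1 := mul_exp_neg_le_one_s11 (x n)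
    have h2 : exp (u n) ≤ exp U := exp_le_exp.2 ((le_abs_self _).trans (hU n))
    nlinarith [exp_pos (u n)]

theorem exists_pos_le_ricker {u : ℕ → ℝ} {U M al lo : ℝ} (hU : ∀ n, |u n| ≤ U)
    (hM : exp U ≤ M) (hal : 0 < al) (hlo : 0 < lo) (hua : ∀ n, al ≤ u n + u (n + 1)) :
    ∃ c > 0, ∀ x : ℕ → ℝ, (∀ n, 0 < x n) → (∀ n, x (n + 1) = x n * exp (u n - x n)) →
      lo ≤ x 0 → x 0 ≤ M → ∀ n, c ≤ x n := by
  set m := min lo (al * exp (-(2 * M))) with hm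
  have hm0 : 0 < m := lt_min hlo (by positivity)
  have hM0 : 0 < M := (exp_pos U).trans_le hM
  refine ⟨m / (1 + exp U), by positivity, fun x hx hu h0 h0M n => ?_⟩
  have hxM := ricker_le hU hu h0M hM
  have hs : ∀ n, m ≤ x n + x (n + 1) := by
    intro n
    induction n with
    | zero => linarith [min_le_left lo (al * exp (-(2 * M))), hx (0 + 1)]
    | succ n ih =>
      have h2 := ricker_two_step hu n
      rw [show n + 1 + 1 = n + 2 from rfl, h2]
      rcases le_total (x n + x (n + 1)) al with h | h
      · have : 1 ≤ exp (u n + u (n + 1) - x n - x (n + 1)) :=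
          one_le_exp (by linarith [hua n])
        nlinarith [hx n]
      · have h3 : exp (-(2 * M)) ≤ exp (u n + u (n + 1) - x n - x (n + 1)) :=
          exp_le_exp.2 (by linarith [hua n, hxM n, hxM (n + 1)])
        have h4 : exp (-(2 * M)) ≤ 1 := exp_le_one_iff.2 (by linarith)
        have h5 : m ≤ al * exp (-(2 * M)) := min_le_right _ _
        have h6 := exp_pos (-(2 * M))
        nlinarith [hx n, hx (n + 1), mul_le_mul_of_nonneg_left h3 (hx n).le,
          mul_le_mul_of_nonneg_left h4 (hx (n + 1)).le, mul_le_mul_of_nonneg_right h h6.le]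
  rw [div_le_iff₀ (by positivity)]
  have h1 : x (n + 1) ≤ x n * exp U := by
    rw [hu n]
    exact mul_le_mul_of_nonneg_left
      (exp_le_exp.2 (by linarith [hx n, (le_abs_self _).trans (hU n)])) (hx n).le
  linarith [hs n]

theorem prod_abs_one_sub_ricker_le {u x : ℕ → ℝ} {c M : ℝ} (hc : 0 < c) (hcx : ∀ n, c ≤ x n)
    (hxM : ∀ n, x n ≤ M) (hu : ∀ n, x (n + 1) = x n * exp (u n - x n))
    (hua : ∀ n, u n + u (n + 1) ≤ 2) (n : ℕ) :
    ∏ k ∈ range (n + 1), |1 - x k| ≤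
      (1 + M) * (exp (c / 3) ^ 2 * (1 + M) * (1 + M * exp 2)) * exp (-(c / 3)) ^ n := by
  have hx : ∀ n, 0 < x n := fun n => hc.trans_le (hcx n)
  have hM0 : 0 < M := (hx 0).trans_le (hxM 0)
  have hl1 : 1 ≤ exp (c / 3) := one_le_exp (by positivity)
  have hweight : ∀ n, exp (c / 3) ^ n * (∏ k ∈ range n, |1 - x (k + 1)|) *
      contractionWeight (exp (c / 3)) (x n) (x (n + 1)) ≤
        contractionWeight (exp (c / 3)) (x 0) (x 1) := by
    intro n
    induction n with
    | zero => simp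
    | succ n ih =>
      refine le_trans ?_ ih
      have hz : x (n + 2) ≤ x n * exp (2 - x n - x (n + 1)) := by
        rw [ricker_two_step hu n]
        exact mul_le_mul_of_nonneg_left (exp_le_exp.2 (by linarith [hua n])) (hx n).le
      have hstep := contractionWeight_step hc (hx n) (hcx (n + 1)) (hcx (n + 2)) hz
      have hP : 0 ≤ ∏ k ∈ range n, |1 - x (k + 1)| := prod_nonneg fun _ _ => abs_nonneg _
      rw [prod_range_succ, pow_succ]
      calc _ = exp (c / 3) ^ n * (∏ k ∈ range n, |1 - x (k + 1)|) *
            (exp (c / 3) * |1 - x (n + 1)| *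
              contractionWeight (exp (c / 3)) (x (n + 1)) (x (n + 2))) := by ring
        _ ≤ _ := mul_le_mul_of_nonneg_left hstep (by positivity)
  have hP : 0 ≤ ∏ k ∈ range n, |1 - x (k + 1)| := prod_nonneg fun _ _ => abs_nonneg _
  have h1 : exp (c / 3) ^ n * (∏ k ∈ range n, |1 - x (k + 1)|) ≤
      exp (c / 3) ^ 2 * (1 + M) * (1 + M * exp 2) :=
    (le_mul_of_one_le_right (by positivity) (one_le_contractionWeight _ _ _)).trans
      ((hweight n).trans (contractionWeight_le hl1 (hx 0) (hx 1) (hxM 0) (hxM 1)))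
  have h2 : exp (-(c / 3)) ^ n * exp (c / 3) ^ n = 1 := by
    rw [← mul_pow, ← exp_add]; simp
  have h3 : |1 - x 0| ≤ 1 + M := abs_le.2 ⟨by linarith [hxM 0], by linarith [hx 0]⟩
  rw [prod_range_succ']
  calc (∏ k ∈ range n, |1 - x (k + 1)|) * |1 - x 0|
      = |1 - x 0| * (exp (c / 3) ^ n * (∏ k ∈ range n, |1 - x (k + 1)|)) *
          exp (-(c / 3)) ^ n := by
        linear_combination (-(∏ k ∈ range n, |1 - x (k + 1)|) * |1 - x 0|) * h2
    _ ≤ _ := by gcongr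

/-- Two solutions of a Ricker equation whose consecutive parameters have sums in `[al, 2]`
approach each other geometrically. -/
theorem exists_abs_log_sub_log_ricker_le {u x x' : ℕ → ℝ} {U al : ℝ} (hU : ∀ n, |u n| ≤ U)
    (hal : 0 < al) (hual : ∀ n, al ≤ u n + u (n + 1)) (hua : ∀ n, u n + u (n + 1) ≤ 2)
    (hx : ∀ n, 0 < x n) (hx' : ∀ n, 0 < x' n)
    (hu : ∀ n, x (n + 1) = x n * exp (u n - x n))
    (hu' : ∀ n, x' (n + 1) = x' n * exp (u n - x' n)) :
    ∃ C r : ℝ, 0 < r ∧ r < 1 ∧ ∀ n, |log (x' n) - log (x n)| ≤ C * r ^ n := by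
  set lo := min (x 0) (x' 0) with hlo
  set M := max (exp U) (max (x 0) (x' 0)) with hM
  have hlo0 : 0 < lo := lt_min (hx 0) (hx' 0)
  have hUM : exp U ≤ M := le_max_left _ _
  have hM0 : 0 < M := (exp_pos U).trans_le hUM
  obtain ⟨c, hc, hcx⟩ := exists_pos_le_ricker hU hUM hal hlo0 hual
  set B := (1 + M) * (exp (c / 3) ^ 2 * (1 + M) * (1 + M * exp 2)) with hB
  have hmem : ∀ t, 0 < t → lo ≤ t → t ≤ M → log t ∈ Set.Icc (log lo) (log M) := fun t h1 h2 h3 =>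
    ⟨log_le_log hlo0 h2, log_le_log h1 h3⟩
  have hm1 := hmem (x 0) (hx 0) (min_le_left _ _) ((le_max_left _ _).trans (le_max_right _ _))
  have hm2 := hmem (x' 0) (hx' 0) (min_le_right _ _) ((le_max_right _ _).trans (le_max_right _ _))
  have hstep : ∀ n, |log (x' (n + 1)) - log (x (n + 1))| ≤
      B * exp (-(c / 3)) ^ n * |log (x' 0) - log (x 0)| := by
    intro n
    rw [← logRicker_log_eq hx hu, ← logRicker_log_eq hx' hu', ← Real.norm_eq_abs,
      ← Real.norm_eq_abs]
    refine (convex_Icc (log lo) (log M)).norm_image_sub_le_of_norm_hasDerivWithin_le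
      (f := fun t => logRicker u t (n + 1))
      (fun t _ => (logRicker_hasDerivAt u t (n + 1)).hasDerivWithinAt) (fun t ht => ?_) hm1 hm2
    have ht1 : lo ≤ exp (logRicker u t 0) := (log_le_iff_le_exp hlo0).1 ht.1
    have ht2 : exp (logRicker u t 0) ≤ M := (le_log_iff_exp_le hM0).1 ht.2
    have hrec := exp_logRicker_succ u t
    rw [norm_prod]
    exact prod_abs_one_sub_ricker_le (x := fun k => exp (logRicker u t k)) hc
      (hcx _ (fun _ => exp_pos _) hrec ht1 ht2) (ricker_le hU hrec ht2 hUM) hrec hua n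
  set r := exp (-(c / 3)) with hr
  have hr0 : 0 < r := exp_pos _
  refine ⟨(1 + B / r) * |log (x' 0) - log (x 0)|, r, hr0, exp_lt_one_iff.2 (by linarith), fun n => ?_⟩
  have hB0 : 0 < B := by positivity
  have hd := abs_nonneg (log (x' 0) - log (x 0))
  rcases n with _ | n
  · rw [pow_zero, mul_one]
    exact le_mul_of_one_le_left hd (by linarith [div_pos hB0 hr0])
  · refine (hstep n).trans ?_
    have : (1 + B / r) * |log (x' 0) - log (x 0)| * r ^ (n + 1) =
        |log (x' 0) - log (x 0)| * r ^ (n + 1) + B * r ^ n * |log (x' 0) - log (x 0)| := by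
      field_simp
      ring
    rw [this]
    linarith [mul_nonneg hd (pow_pos hr0 (n + 1)).le]

theorem Function.Periodic.exists_forall_abs_le {f : ℕ → ℝ} {p : ℕ} (hf : Function.Periodic f p)
    (hp : 0 < p) : ∃ U, ∀ n, |f n| ≤ U := by
  obtain ⟨i, -, hi⟩ := exists_max_image (range p) (fun k => |f k|) ⟨0, mem_range.2 hp⟩
  refine ⟨|f i|, fun n => ?_⟩
  rw [← hf.map_mod_nat n]
  exact hi _ (mem_range.2 (Nat.mod_lt n hp))

/-- If `u n + u (n + 1)` has odd period `p`, then `u` has period `2 * p`. -/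
theorem periodic_two_mul_of_add_succ {u a : ℕ → ℝ} {p : ℕ} (hodd : Odd p)
    (ha : Function.Periodic a p) (hua : ∀ n, u n + u (n + 1) = a n) :
    Function.Periodic u (2 * p) := by
  have hw : ∀ n k, u (n + k + p) - u (n + k) = (-1) ^ k * (u (n + p) - u n) := by
    intro n k
    induction k with
    | zero => simp
    | succ k ih =>
      have h1 := hua (n + k)
      have h2 := hua (n + k + p)
      rw [ha (n + k), show n + k + p + 1 = n + (k + 1) + p by ring] at h2
      rw [pow_succ]
      rw [show n + k + 1 = n + (k + 1) by ring] at h1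
      linarith
  intro n
  have h := hw n p
  rw [hodd.neg_one_pow, show n + p + p = n + 2 * p by ring] at h
  linarith

/-- A sequence whose `q`-step increments decay geometrically converges to a `q`-periodic one. -/
theorem exists_periodic_limit_s11 {X : ℕ → ℝ} {q : ℕ} {C r : ℝ} (hq : 0 < q) (hr0 : 0 < r)
    (hr1 : r < 1) (hX : ∀ n, |X (n + q) - X n| ≤ C * r ^ n) :
    ∃ Y : ℕ → ℝ, (∀ n, Y (n + q) = Y n) ∧
      (∀ n, Tendsto (fun k => X (n + k * q)) atTop (𝓝 (Y n))) ∧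
      Tendsto (fun n => |X n - Y n|) atTop (𝓝 0) := by
  have hrq : r ^ q < 1 := pow_lt_one₀ hr0.le hr1 hq.ne'
  have hgeo : ∀ n k, dist (X (n + k * q)) (X (n + (k + 1) * q)) ≤ C * r ^ n * (r ^ q) ^ k := by
    intro n k
    rw [dist_comm, Real.dist_eq, show n + (k + 1) * q = n + k * q + q by ring]
    refine (hX _).trans_eq ?_
    rw [pow_add, ← pow_mul, mul_comm k q]
    ring
  choose Y hY using fun n => cauchySeq_tendsto_of_complete
    (cauchySeq_of_le_geometric (r ^ q) (C * r ^ n) hrq (hgeo n))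
  refine ⟨Y, fun n => ?_, hY, ?_⟩
  · refine tendsto_nhds_unique (hY (n + q)) ?_
    have h := (hY n).comp (tendsto_add_atTop_nat 1)
    refine h.congr fun k => ?_
    simp only [Function.comp]
    congr 1
    ring
  · refine squeeze_zero (fun n => abs_nonneg _) (g := fun n => C / (1 - r ^ q) * r ^ n)
      (fun n => ?_) ?_
    · have h := dist_le_of_le_geometric_of_tendsto₀ (r ^ q) (C * r ^ n) hrq (hgeo n) (hY n)
      rw [Real.dist_eq, zero_mul, add_zero] at h
      refine h.trans_eq ?_
      ring
    · simpa using (tendsto_pow_atTop_nhds_zero_of_lt_one hr0.le hr1).const_mul (C / (1 - r ^ q))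

theorem abs_sub_le_mul_abs_log_sub_log {s t M : ℝ} (hs : 0 < s) (ht : 0 < t) (hsM : s ≤ M)
    (htM : t ≤ M) : |s - t| ≤ M * |log s - log t| := by
  wlog h : t ≤ s generalizing s t
  · rw [abs_sub_comm, abs_sub_comm (log s)]
    exact this ht hs htM hsM (le_of_not_ge h)
  have hlog : 0 ≤ log s - log t := sub_nonneg.2 (log_le_log ht h)
  rw [abs_of_nonneg (sub_nonneg.2 h), abs_of_nonneg hlog]
  have h2 : t = s * exp (-(log s - log t)) := by
    rw [neg_sub, exp_sub, exp_log hs, exp_log ht]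
    field_simp
  have h3 := add_one_le_exp (-(log s - log t))
  nlinarith

/- Statement 11 (Corollary op(a)): {a_n} periodic with minimal odd period p and 0 < a_i < 2.
Every solution with positive initial values converges to a periodic solution of period 2p
(depending on the initial values).  We index X : ℕ → ℝ with X n = x_{n-1}. -/
theorem stmt_11 (a : ℕ → ℝ) (p : ℕ) (hp : 0 < p) (hodd : Odd p)
    (hper : Function.Periodic a p)
    (hmin : ∀ q : ℕ, 0 < q → Function.Periodic a q → p ≤ q)
    (ha : ∀ i : ℕ, i < p → 0 < a i ∧ a i < 2)
    (X : ℕ → ℝ) (hx0 : 0 < X 0) (hx1 : 0 < X 1)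
    (hrec : ∀ n : ℕ, X (n + 2) = X n * Real.exp (a n - X n - X (n + 1))) :
    ∃ Y : ℕ → ℝ,
      (∀ n : ℕ, Y (n + 2) = Y n * Real.exp (a n - Y n - Y (n + 1))) ∧
      (∀ n : ℕ, Y (n + 2 * p) = Y n) ∧
      Filter.Tendsto (fun n => |X n - Y n|) Filter.atTop (nhds 0) := by
  have hX : ∀ n, 0 < X n := by
    have h : ∀ n, 0 < X n ∧ 0 < X (n + 1) := by
      intro n
      induction n with
      | zero => exact ⟨hx0, hx1⟩
      | succ n ih => exact ⟨ih.2, by rw [hrec n]; exact mul_pos ih.1 (exp_pos _)⟩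
    exact fun n => (h n).1
  have ha2 : ∀ n, a n ≤ 2 := fun n => by
    rw [← hper.map_mod_nat n]; exact (ha _ (Nat.mod_lt n hp)).2.le
  obtain ⟨al, hal, haal⟩ : ∃ al > 0, ∀ n, al ≤ a n := by
    obtain ⟨i, hi, hmini⟩ := exists_min_image (range p) a ⟨0, mem_range.2 hp⟩
    refine ⟨a i, (ha i (mem_range.1 hi)).1, fun n => ?_⟩
    rw [← hper.map_mod_nat n]
    exact hmini _ (mem_range.2 (Nat.mod_lt n hp))
  -- The equation splits into a Ricker recursion whose parameter satisfies `u n + u (n + 1) = a n`.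
  set u : ℕ → ℝ := fun n => log (X (n + 1)) - log (X n) + X n with hudef
  have hu : ∀ n, X (n + 1) = X n * exp (u n - X n) := fun n => by
    simp only [hudef, add_sub_cancel_right]
    rw [exp_sub, exp_log (hX _), exp_log (hX _), mul_div_cancel₀ _ (hX n).ne']
  have hua : ∀ n, u n + u (n + 1) = a n := fun n => by
    simp only [hudef]
    rw [show n + 1 + 1 = n + 2 from rfl, hrec n, log_mul (hX n).ne' (exp_pos _).ne', log_exp]
    ring
  have huper := periodic_two_mul_of_add_succ hodd hper hua
  have h2p : 0 < 2 * p := by omega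
  obtain ⟨U, hU⟩ := huper.exists_forall_abs_le h2p
  have hu' : ∀ n, X (n + 1 + 2 * p) = X (n + 2 * p) * exp (u n - X (n + 2 * p)) := fun n => by
    rw [show n + 1 + 2 * p = n + 2 * p + 1 by ring, hu, huper n]
  obtain ⟨C, r, hr0, hr1, hC⟩ := exists_abs_log_sub_log_ricker_le (x' := fun n => X (n + 2 * p))
    hU hal (fun n => (haal n).trans_eq (hua n).symm) (fun n => (hua n).trans_le (ha2 n)) hX
    (fun n => hX _) hu hu'
  set M := max (X 0) (exp U) with hMdef
  have hXM := ricker_le hU hu (le_max_left (X 0) (exp U)) (le_max_right _ _)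
  have hM0 : 0 ≤ M := (exp_pos U).le.trans (le_max_right _ _)
  have hdiff : ∀ n, |X (n + 2 * p) - X n| ≤ M * C * r ^ n := fun n =>
    (abs_sub_le_mul_abs_log_sub_log (hX _) (hX _) (hXM _) (hXM _)).trans
      ((mul_le_mul_of_nonneg_left (hC n) hM0).trans_eq (by ring))
  obtain ⟨Y, hYper, hYlim, hXY⟩ := exists_periodic_limit_s11 h2p hr0 hr1 hdiff
  refine ⟨Y, fun n => ?_, hYper, hXY⟩
  refine tendsto_nhds_unique (hYlim (n + 2)) ?_
  have hlim : Tendsto (fun k => X (n + k * (2 * p)) *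
      exp (a n - X (n + k * (2 * p)) - X (n + 1 + k * (2 * p)))) atTop
      (𝓝 (Y n * exp (a n - Y n - Y (n + 1)))) :=
    (hYlim n).mul ((continuous_exp.tendsto _).comp
      ((tendsto_const_nhds.sub (hYlim n)).sub (hYlim (n + 1))))
  refine hlim.congr fun k => ?_
  have hak : a (n + k * (2 * p)) = a n := by
    rw [← mul_assoc]
    exact_mod_cast hper.nat_mul (k * 2) n
  rw [show n + 2 + k * (2 * p) = n + k * (2 * p) + 2 by ring, hrec, hak,
    show n + k * (2 * p) + 1 = n + 1 + k * (2 * p) by ring]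
end

section
/- Suppose {a_n}_{n≥0} is periodic with minimal even period p ≥ 2 and set σ = Σ_{j=1}^{p} (−1)^j a_{j−1}. Let {x_n} be any solution of x_{n+1} = x_{n−1}·exp(a_n − x_{n−1} − x_n) with initial values x_{−1}, x_0 > 0. If σ > 0, then lim_{n→∞} x_{2n+1} = 0; if σ < 0, then lim_{n→∞} x_{2n} = 0. -/
open Filter in
/-- A sequence that increases by a fixed positive amount over each period tends to infinity. -/
lemma tendsto_atTop_of_add_eq_add {g : ℕ → ℝ} {m : ℕ} {s : ℝ} (hm : 0 < m) (hs : 0 < s)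
    (hg : ∀ n, g (n + m) = g n + s) : Tendsto g atTop atTop := by
  have hm' : (0 : ℝ) < m := by exact_mod_cast hm
  have hf : Function.Periodic (fun n : ℕ => g n - s / m * n) m := fun n => by
    simp only [hg, Nat.cast_add]
    field_simp
    ring
  obtain ⟨b, hb⟩ := ((Finset.range m).image fun n : ℕ => g n - s / m * n).bddBelow
  refine tendsto_atTop_mono (f := fun n : ℕ => s / m * n + b) (fun n => ?_)
    (tendsto_atTop_add_const_right _ _
      (tendsto_natCast_atTop_atTop.const_mul_atTop (div_pos hs hm')))
  have h₁ := hf.map_mod_nat n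
  have h₂ : b ≤ g (n % m) - s / m * (n % m : ℕ) := hb <| by
    simp only [Finset.coe_image, Finset.coe_range]
    exact ⟨n % m, Nat.mod_lt n hm, rfl⟩
  linarith

/-- A periodic real sequence is bounded above. -/
lemma Function.Periodic.exists_forall_le_nat {a : ℕ → ℝ} {p : ℕ} (hp : 0 < p)
    (ha : Function.Periodic a p) : ∃ A, ∀ n, a n ≤ A := by
  obtain ⟨A, hA⟩ := ((Finset.range p).image a).bddAbove
  refine ⟨A, fun n => ?_⟩
  rw [← ha.map_mod_nat n]
  apply hA
  simp only [Finset.coe_image, Finset.coe_range]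
  exact ⟨n % p, Nat.mod_lt n hp, rfl⟩

lemma sum_Icc_neg_one_pow_mul_eq_sum_range (a : ℕ → ℝ) (m : ℕ) :
    ∑ j ∈ Finset.Icc 1 (2 * m), (-1 : ℝ) ^ j * a (j - 1) =
      ∑ k ∈ Finset.range m, (a (2 * k + 1) - a (2 * k)) := by
  induction m with
  | zero => simp
  | succ m ih =>
    rw [Finset.sum_range_succ, ← ih, show 2 * (m + 1) = 2 * m + 1 + 1 by ring,
      Finset.sum_Icc_succ_top (by omega), Finset.sum_Icc_succ_top (by omega)]
    simp only [pow_succ, pow_mul, Nat.add_sub_cancel]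
    norm_num
    ring

section Recurrence

variable {a X : ℕ → ℝ}

lemma pos_of_exp_recurrence (hx0 : 0 < X 0) (hx1 : 0 < X 1)
    (hrec : ∀ n, X (n + 2) = X n * Real.exp (a n - X n - X (n + 1))) (n : ℕ) : 0 < X n := by
  induction n using Nat.twoStepInduction with
  | zero => exact hx0
  | one => exact hx1
  | more n h _ => rw [hrec]; positivity

lemma log_add_two_of_exp_recurrence (hpos : ∀ n, 0 < X n)
    (hrec : ∀ n, X (n + 2) = X n * Real.exp (a n - X n - X (n + 1))) (n : ℕ) :
    Real.log (X (n + 2)) = Real.log (X n) + (a n - X n - X (n + 1)) := by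
  rw [hrec, Real.log_mul (hpos n).ne' (Real.exp_pos _).ne', Real.log_exp]

/-- The logarithms of consecutive terms of a solution differ by a telescoping expression. -/
lemma log_sub_log_of_exp_recurrence (hpos : ∀ n, 0 < X n)
    (hrec : ∀ n, X (n + 2) = X n * Real.exp (a n - X n - X (n + 1))) (n : ℕ) :
    Real.log (X (2 * n)) - X (2 * n) - Real.log (X (2 * n + 1)) =
      Real.log (X 0) - X 0 - Real.log (X 1) -
        ∑ k ∈ Finset.range n, (a (2 * k + 1) - a (2 * k)) := by
  induction n with
  | zero => simp
  | succ n ih =>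
    have h₀ := log_add_two_of_exp_recurrence hpos hrec (2 * n)
    have h₁ := log_add_two_of_exp_recurrence hpos hrec (2 * n + 1)
    rw [Finset.sum_range_succ, show 2 * (n + 1) = 2 * n + 2 by ring,
      show 2 * n + 2 + 1 = 2 * n + 1 + 2 by ring]
    linarith

lemma log_add_two_le_of_exp_recurrence (hpos : ∀ n, 0 < X n)
    (hrec : ∀ n, X (n + 2) = X n * Real.exp (a n - X n - X (n + 1)))
    {A : ℝ} (hA : ∀ n, a n ≤ A) (n : ℕ) : Real.log (X (n + 2)) ≤ A := by
  have h := log_add_two_of_exp_recurrence hpos hrec n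
  linarith [hA n, hpos (n + 1), Real.log_le_sub_one_of_pos (hpos n)]

end Recurrence

open Filter in
lemma tendsto_zero_of_log_tendsto_atBot {u : ℕ → ℝ} (hpos : ∀ n, 0 < u n)
    (h : Tendsto (fun n => Real.log (u n)) atTop atBot) : Tendsto u atTop (nhds 0) :=
  (Real.tendsto_exp_atBot.comp h).congr fun n => Real.exp_log (hpos n)

/- Statement 18 (Lemma 1h): {a_n} periodic with minimal even period p ≥ 2,
σ = Σ_{j=1}^p (-1)^j a_{j-1}.  For any solution of (E) with x_{-1}, x_0 > 0:
if σ > 0 then x_{2n+1} → 0, and if σ < 0 then x_{2n} → 0.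
We index X : ℕ → ℝ with X n = x_{n-1}; thus x_{2n+1} = X (2n+2), x_{2n} = X (2n+1). -/
theorem stmt_18 (a : ℕ → ℝ) (p : ℕ) (hp : 2 ≤ p) (heven : Even p)
    (hper : Function.Periodic a p)
    (hmin : ∀ r : ℕ, 0 < r → Function.Periodic a r → p ≤ r)
    (σ : ℝ) (hσ : σ = ∑ j ∈ Finset.Icc 1 p, (-1 : ℝ) ^ j * a (j - 1))
    (X : ℕ → ℝ) (hx0 : 0 < X 0) (hx1 : 0 < X 1)
    (hrec : ∀ n : ℕ, X (n + 2) = X n * Real.exp (a n - X n - X (n + 1))) :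
    (0 < σ → Filter.Tendsto (fun n => X (2 * n + 2)) Filter.atTop (nhds 0)) ∧
    (σ < 0 → Filter.Tendsto (fun n => X (2 * n + 1)) Filter.atTop (nhds 0)) := by
  obtain ⟨m, rfl⟩ := heven.two_dvd
  have hm : 0 < m := by omega
  have hpos := pos_of_exp_recurrence hx0 hx1 hrec
  obtain ⟨A, hA⟩ := hper.exists_forall_le_nat (by omega)
  have hlog := log_add_two_le_of_exp_recurrence hpos hrec hA
  have htel := log_sub_log_of_exp_recurrence hpos hrec
  rw [sum_Icc_neg_one_pow_mul_eq_sum_range] at hσ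
  set D : ℕ → ℝ := fun n => ∑ k ∈ Finset.range n, (a (2 * k + 1) - a (2 * k)) with hD
  have hadd : ∀ n, D (n + m) = D n + σ := fun n => by
    simp only [hD, hσ]
    rw [add_comm n m, Finset.sum_range_add, add_comm]
    congr 1
    refine Finset.sum_congr rfl fun k _ => ?_
    rw [← hper (2 * k + 1), ← hper (2 * k)]
    ring_nf
  set c : ℝ := Real.log (X 0) - X 0 - Real.log (X 1)
  refine ⟨fun hs => ?_, fun hs => ?_⟩
  · have hDtop : Filter.Tendsto (fun n => D (n + 1)) Filter.atTop Filter.atTop :=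
      (tendsto_atTop_of_add_eq_add hm hs hadd).comp (Filter.tendsto_add_atTop_nat 1)
    refine tendsto_zero_of_log_tendsto_atBot (fun n => hpos _) ?_
    refine Filter.tendsto_atBot_mono (f := fun n => (Real.exp A + A + c) + -D (n + 1))
      (fun n => ?_) (Filter.tendsto_atBot_add_const_left _ _
        (Filter.tendsto_neg_atTop_atBot.comp hDtop))
    have h₀ : X (2 * n + 2) ≤ Real.exp A := (Real.log_le_iff_le_exp (hpos _)).1 (hlog (2 * n))
    have h₁ : Real.log (X (2 * n + 3)) ≤ A := hlog (2 * n + 1)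
    have h₂ : Real.log (X (2 * n + 2)) - X (2 * n + 2) - Real.log (X (2 * n + 3)) =
      c - D (n + 1) := htel (n + 1)
    linarith
  · have hDtop : Filter.Tendsto (fun n => -D n) Filter.atTop Filter.atTop :=
      tendsto_atTop_of_add_eq_add hm (neg_pos.2 hs) fun n => by rw [hadd]; ring
    refine tendsto_zero_of_log_tendsto_atBot (fun n => hpos _) ?_
    refine Filter.tendsto_atBot_mono (f := fun n => -c + -(-D n))
      (fun n => ?_) (Filter.tendsto_atBot_add_const_left _ _
        (Filter.tendsto_neg_atTop_atBot.comp hDtop))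
    have h₂ : Real.log (X (2 * n)) - X (2 * n) - Real.log (X (2 * n + 1)) = c - D n := htel n
    have h₃ := Real.log_le_sub_one_of_pos (hpos (2 * n))
    linarith
end
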